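/- arXiv:1406.6712 — 2 statements merged into one kernel-verified Lean document; each statement's English description precedes it below -/
import Mathlib

section
/- Let N, m, s be positive integers, let 𝒜 : M_N → ℝ^m be a linear map, and let α_{2s}, β_{2s} be the best constants with α_{2s} ‖Z‖_{S_2} ≤ ‖𝒜Z‖_{ℓ2} ≤ β_{2s} ‖Z‖_{S_2} for all Z ∈ M_N of rank at most 2s; assume α_{2s} > 0. If γ_{2s} := β_{2s}^2/α_{2s}^2 < 4√2 − 3, then for every X ∈ M_N with rank(X) ≤ s, every minimizer X* of the nuclear norm ‖Z‖_{S_1} over all Z ∈ M_N with 𝒜Z = 𝒜X equals X. -/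
noncomputable def singVals {N : ℕ} (X : Matrix (Fin N) (Fin N) ℝ) : Fin N → ℝ :=
  fun i => Real.sqrt ((Matrix.isHermitian_conjTranspose_mul_self X).eigenvalues i)

/-- The Schatten `p`-quasi-norm of a real `N × N` matrix. -/
noncomputable def schattenNorm {N : ℕ} (p : ℝ) (X : Matrix (Fin N) (Fin N) ℝ) : ℝ :=
  (∑ i, singVals X i ^ p) ^ (1 / p)

open Module InnerProductSpace Finset

section SingularValueInequalities
variable {E : Type*} [NormedAddCommGroup E] [InnerProductSpace ℝ E]

/-- The quadratic form of an operator on a combination of orthonormal eigenvectors. -/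
lemma inner_apply_sum_of_eigenvectors {ι : Type*} {w : ι → E} (hw : Orthonormal ℝ w)
    {T : E →ₗ[ℝ] E} {μ : ι → ℝ} (hT : ∀ k, T (w k) = μ k • w k) (S : Finset ι) (a : ι → ℝ) :
    inner ℝ (T (∑ k ∈ S, a k • w k)) (∑ k ∈ S, a k • w k) = ∑ k ∈ S, μ k * a k ^ 2 := by
  have h : T (∑ k ∈ S, a k • w k) = ∑ k ∈ S, (μ k * a k) • w k := by
    simp only [map_sum, map_smul, hT, smul_smul, mul_comm]
  rw [h, hw.inner_sum]
  refine sum_congr rfl fun k _ => ?_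
  simp; ring

lemma norm_sq_sum_smul_orthonormal {ι : Type*} {w : ι → E} (hw : Orthonormal ℝ w)
    (S : Finset ι) (a : ι → ℝ) : ‖∑ k ∈ S, a k • w k‖ ^ 2 = ∑ k ∈ S, a k ^ 2 := by
  rw [← real_inner_self_eq_norm_sq, hw.inner_sum]
  refine sum_congr rfl fun k _ => ?_
  simp [sq]

lemma finrank_span_image_orthonormal {ι : Type*} {w : ι → E} (hw : Orthonormal ℝ w)
    (S : Finset ι) : finrank ℝ (Submodule.span ℝ (w '' S)) = S.card := by
  rw [Set.image_eq_range]
  have h := (hw.comp (fun k : S => (k : ι)) Subtype.val_injective).linearIndependent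
  exact (finrank_span_eq_card h).trans (Fintype.card_coe S)

/-- Weyl monotonicity: if `T ≤ M` and `T` has more than `j` orthonormal eigenvectors with
eigenvalue at least `c`, then the `j`-th largest eigenvalue of `M` is at least `c`. -/
lemma le_eigenvalues_of_orthonormal_eigenvectors [FiniteDimensional ℝ E]
    {M T : E →ₗ[ℝ] E} (hM : M.IsSymmetric) {d : ℕ} (hd : finrank ℝ E = d) (j : Fin d)
    {ι : Type*} {w : ι → E} (hw : Orthonormal ℝ w) {μ : ι → ℝ}
    (hT : ∀ k, T (w k) = μ k • w k) (hTM : ∀ x, inner ℝ (T x) x ≤ inner ℝ (M x) x)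
    (S : Finset ι) (hS : (j : ℕ) + 1 ≤ S.card) {c : ℝ} (hc : ∀ k ∈ S, c ≤ μ k) :
    c ≤ hM.eigenvalues hd j := by
  classical
  set b := hM.eigenvectorBasis hd
  have hb : Orthonormal ℝ b := b.orthonormal
  have hbM : ∀ k, M (b k) = hM.eigenvalues hd k • b k := fun k =>
    hM.apply_eigenvectorBasis hd k
  let W := Submodule.span ℝ (w '' S)
  let V := Submodule.span ℝ (b '' (Ici j : Finset (Fin d)))
  have hW : finrank ℝ W = S.card := finrank_span_image_orthonormal hw S
  have hV : finrank ℝ V = d - j := by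
    simpa using finrank_span_image_orthonormal hb (Ici j)
  have hne : W ⊓ V ≠ ⊥ := by
    intro h
    have h1 := Submodule.finrank_sup_add_finrank_inf_eq W V
    have h2 := Submodule.finrank_le (W ⊔ V)
    rw [h, finrank_bot] at h1
    have := j.2
    omega
  obtain ⟨x, hx, hx0⟩ := Submodule.exists_mem_ne_zero_of_ne_bot hne
  obtain ⟨hxW, hxV⟩ := Submodule.mem_inf.1 hx
  have hpos : 0 < ‖x‖ ^ 2 := by positivity
  have key : c * ‖x‖ ^ 2 ≤ inner ℝ (T x) x := by
    obtain ⟨a, rfl⟩ : ∃ a : ι → ℝ, ∑ k ∈ S, a k • w k = x :=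
      (Submodule.mem_span_image_finset_iff_exists_fun' ℝ).1 hxW
    rw [inner_apply_sum_of_eigenvectors hw hT, norm_sq_sum_smul_orthonormal hw, mul_sum]
    exact sum_le_sum fun k hk => mul_le_mul_of_nonneg_right (hc k hk) (sq_nonneg _)
  have key2 : inner ℝ (M x) x ≤ hM.eigenvalues hd j * ‖x‖ ^ 2 := by
    obtain ⟨a, rfl⟩ : ∃ a : Fin d → ℝ, ∑ k ∈ Ici j, a k • b k = x :=
      (Submodule.mem_span_image_finset_iff_exists_fun' ℝ).1 hxV
    rw [inner_apply_sum_of_eigenvectors hb hbM, norm_sq_sum_smul_orthonormal hb, mul_sum]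
    exact sum_le_sum fun k hk => mul_le_mul_of_nonneg_right
      (hM.eigenvalues_antitone hd (mem_Ici.1 hk)) (sq_nonneg _)
  exact le_of_mul_le_mul_right (key.trans ((hTM x).trans key2)) hpos

/-- Singular value decomposition of an endomorphism. -/
lemma exists_singular_value_decomposition [FiniteDimensional ℝ E] (T : E →ₗ[ℝ] E) {n : ℕ}
    (hn : finrank ℝ E = n) :
    ∃ u v : OrthonormalBasis (Fin n) ℝ E, (∀ i, T (v i) = T.singularValues i • u i) ∧
      ∀ i, LinearMap.adjoint T (u i) = T.singularValues i • v i := by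
  set v := T.isSymmetric_adjoint_comp_self.eigenvectorBasis hn with hv
  have hvT : ∀ i, LinearMap.adjoint T (T (v i)) = T.singularValues i ^ 2 • v i := fun i => by
    rw [T.sq_singularValues_fin hn]
    exact T.isSymmetric_adjoint_comp_self.apply_eigenvectorBasis hn i
  have hin : ∀ i j, inner ℝ (T (v i)) (T (v j)) = if i = j then T.singularValues i ^ 2 else 0 := by
    intro i j
    rw [← LinearMap.adjoint_inner_left, hvT, inner_smul_left, v.inner_eq_ite]
    simp
  obtain ⟨u, hu⟩ := Orthonormal.exists_orthonormalBasis_extension_of_card_eq (𝕜 := ℝ)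
    (E := E) (ι := Fin n) (by simpa using hn) (v := fun i => (T.singularValues i)⁻¹ • T (v i))
    (s := {i | T.singularValues i ≠ 0}) (by
      rw [orthonormal_iff_ite]
      rintro ⟨i, hi⟩ ⟨j, hj⟩
      simp only [Set.domRestrict_apply, inner_smul_left, inner_smul_right, hin, Subtype.mk.injEq]
      split_ifs with h
      · subst h
        have : T.singularValues i ≠ 0 := hi
        simp; field_simp
      · simp)
  have huv : ∀ i, T (v i) = T.singularValues i • u i := fun i => by
    by_cases hi : T.singularValues i = 0
    · rw [hi, zero_smul, ← inner_self_eq_zero (𝕜 := ℝ), hin]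
      simp [hi]
    · rw [hu i hi, smul_inv_smul₀ hi]
  refine ⟨u, v, huv, fun i => ext_inner_left_basis (𝕜 := ℝ) v.toBasis fun j => ?_⟩
  rw [v.coe_toBasis, LinearMap.adjoint_inner_right, huv, inner_smul_left, inner_smul_right, v.inner_eq_ite,
    u.inner_eq_ite]
  by_cases h : j = i <;> simp [h]

/-- An operator that is diagonal, with prescribed real entries, in an orthonormal basis. -/
lemma exists_isSymmetric_apply_orthonormalBasis {ι : Type*} [Fintype ι]
    (e : OrthonormalBasis ι ℝ E) (ν : ι → ℝ) :
    ∃ P : E →ₗ[ℝ] E, P.IsSymmetric ∧ ∀ k, P (e k) = ν k • e k := by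
  classical
  refine ⟨∑ k, ν k • (innerₛₗ ℝ (e k)).smulRight (e k), fun x y => ?_, fun k => ?_⟩
  · simp only [LinearMap.sum_apply, LinearMap.smul_apply, LinearMap.smulRight_apply,
      innerₛₗ_apply_apply, sum_inner, inner_sum, inner_smul_left, inner_smul_right]
    refine sum_congr rfl fun k _ => ?_
    rw [real_inner_comm x (e k), conj_trivial, conj_trivial]
    ring
  · simp [LinearMap.sum_apply, e.inner_eq_ite]

/-- The Jordan–Wielandt dilation `(x, y) ↦ (T y, T† x)` of an endomorphism `T`. -/
noncomputable def jordanWielandt [FiniteDimensional ℝ E] (T : E →ₗ[ℝ] E) :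
    WithLp 2 (E × E) →ₗ[ℝ] WithLp 2 (E × E) where
  toFun z := WithLp.toLp 2 (T z.snd, LinearMap.adjoint T z.fst)
  map_add' x y := by simp [← WithLp.toLp_add]
  map_smul' r x := by simp [← WithLp.toLp_smul]

variable [FiniteDimensional ℝ E]

lemma jordanWielandt_apply (T : E →ₗ[ℝ] E) (z : WithLp 2 (E × E)) :
    jordanWielandt T z = WithLp.toLp 2 (T z.snd, LinearMap.adjoint T z.fst) := rfl

lemma isSymmetric_jordanWielandt (T : E →ₗ[ℝ] E) : (jordanWielandt T).IsSymmetric := by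
  intro x y
  simp [jordanWielandt_apply, LinearMap.adjoint_inner_left, LinearMap.adjoint_inner_right]
  ring

lemma jordanWielandt_add (S T : E →ₗ[ℝ] E) :
    jordanWielandt (S + T) = jordanWielandt S + jordanWielandt T := by
  ext z : 1
  simp [jordanWielandt_apply, ← WithLp.toLp_add]

/-- The Jordan–Wielandt dilation of `T` has an orthonormal eigenbasis with eigenvalues `± σᵢ(T)`. -/
lemma exists_eigenbasis_jordanWielandt (T : E →ₗ[ℝ] E) {n : ℕ} (hn : finrank ℝ E = n) :
    ∃ e : OrthonormalBasis (Fin n ⊕ Fin n) ℝ (WithLp 2 (E × E)),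
      ∀ k, jordanWielandt T (e k) =
        Sum.elim (fun i : Fin n => T.singularValues i) (fun i : Fin n => -T.singularValues i) k
          • e k := by
  obtain ⟨u, v, huv, hvu⟩ := exists_singular_value_decomposition T hn
  let w : Fin n ⊕ Fin n → WithLp 2 (E × E) := Sum.elim
    (fun i => (√2)⁻¹ • WithLp.toLp 2 (u i, v i)) (fun i => (√2)⁻¹ • WithLp.toLp 2 (u i, -v i))
  have h2 : (√2)⁻¹ * (√2)⁻¹ = (2 : ℝ)⁻¹ := by rw [← mul_inv, Real.mul_self_sqrt zero_le_two]
  have hw : Orthonormal ℝ w := by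
    rw [orthonormal_iff_ite]
    rintro (i | i) (j | j) <;>
      simp [w, inner_smul_left, inner_smul_right, ← mul_assoc, h2, u.inner_eq_ite, v.inner_eq_ite] <;>
      split_ifs <;> norm_num
  obtain ⟨e, he⟩ := Orthonormal.exists_orthonormalBasis_extension_of_card_eq (𝕜 := ℝ)
    (E := WithLp 2 (E × E)) (ι := Fin n ⊕ Fin n)
    (by simp [(WithLp.linearEquiv 2 ℝ (E × E)).finrank_eq, hn]) (v := w) (s := Set.univ)
    (hw.comp _ Subtype.val_injective)
  refine ⟨e, fun k => ?_⟩
  rw [he k trivial]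
  rcases k with i | i <;>
    simp [w, jordanWielandt_apply, huv, hvu, ← WithLp.toLp_smul, ← WithLp.toLp_neg,
      smul_comm (√2)⁻¹]

/-- A Mirsky-type inequality for perturbations of operators of rank at most `s`. -/
theorem sum_singularValues_le_sum_singularValues_add (X H : E →ₗ[ℝ] E) {n s : ℕ}
    (hn : finrank ℝ E = n) (hX : finrank ℝ X.range ≤ s) :
    ∑ i : Fin n, (if (i : ℕ) < s then X.singularValues i - H.singularValues i
      else H.singularValues i) ≤ ∑ i : Fin n, (X + H).singularValues i := by
  obtain ⟨eC, hC⟩ := exists_eigenbasis_jordanWielandt (X + H) hn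
  obtain ⟨eX, heX⟩ := exists_eigenbasis_jordanWielandt X hn
  obtain ⟨eH, heH⟩ := exists_eigenbasis_jordanWielandt H hn
  obtain ⟨P, hPs, hP⟩ := exists_isSymmetric_apply_orthonormalBasis eC
    (Sum.elim (fun i : Fin n => (X + H).singularValues i) (fun _ => 0))
  have hPle : ∀ μ : Fin n ⊕ Fin n → ℝ, ∀ T : WithLp 2 (E × E) →ₗ[ℝ] WithLp 2 (E × E),
      (∀ k, T (eC k) = μ k • eC k) →
      (∀ k, μ k ≤ Sum.elim (fun i : Fin n => (X + H).singularValues i) (fun _ => 0) k) →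
      ∀ x, inner ℝ (T x) x ≤ inner ℝ (P x) x := by
    intro μ T hT hμ x
    rw [← eC.sum_repr x, inner_apply_sum_of_eigenvectors eC.orthonormal hT,
      inner_apply_sum_of_eigenvectors eC.orthonormal hP]
    exact sum_le_sum fun k _ => mul_le_mul_of_nonneg_right (hμ k) (sq_nonneg _)
  have hP0 : ∀ x, 0 ≤ inner ℝ (P x) x := fun x => by
    simpa using hPle (fun _ => 0) 0 (by simp) (by simp [LinearMap.singularValues_nonneg]) x
  have hPC := hPle _ _ hC (by simp [LinearMap.singularValues_nonneg])
  have hM : (P - jordanWielandt H).IsSymmetric := hPs.sub (isSymmetric_jordanWielandt H)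
  have hd : finrank ℝ (WithLp 2 (E × E)) = n + n := by
    simp [(WithLp.linearEquiv 2 ℝ (E × E)).finrank_eq, hn]
  have hMX : ∀ x, inner ℝ (jordanWielandt X x) x ≤ inner ℝ ((P - jordanWielandt H) x) x := by
    intro x
    have := hPC x
    rw [jordanWielandt_add, LinearMap.add_apply, inner_add_left] at this
    rw [LinearMap.sub_apply, inner_sub_left]
    linarith
  have hMH : ∀ x, inner ℝ ((-jordanWielandt H) x) x ≤ inner ℝ ((P - jordanWielandt H) x) x := by
    intro x
    rw [LinearMap.sub_apply, inner_sub_left, LinearMap.neg_apply, inner_neg_left]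
    linarith [hP0 x]
  have heH' : ∀ k, (-jordanWielandt H) (eH k) = (-Sum.elim (fun i : Fin n => H.singularValues i)
      (fun i : Fin n => -H.singularValues i) k) • eH k := fun k => by
    rw [LinearMap.neg_apply, heH, neg_smul]
  have hX0 : ∀ i, s ≤ i → X.singularValues i = 0 := fun i hi =>
    X.singularValues_eq_zero_iff_le_finrank_range.2 (hX.trans hi)
  have htop : ∀ i : Fin n, (if (i : ℕ) < s then X.singularValues i else H.singularValues i) ≤
      hM.eigenvalues hd (Fin.castAdd n i) := by
    intro i
    split_ifs with hi
    · refine le_eigenvalues_of_orthonormal_eigenvectors hM hd _ eX.orthonormal heX hMX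
        ((Iic i).disjSum ∅) (by simp) ?_
      simpa using fun (k : Fin n) (hk : k ≤ i) => X.singularValues_antitone (Fin.le_def.1 hk)
    · refine le_eigenvalues_of_orthonormal_eigenvectors hM hd _ eH.orthonormal heH' hMH
        (disjSum ∅ (Iic i)) (by simp) ?_
      simpa using fun (k : Fin n) (hk : k ≤ i) => H.singularValues_antitone (Fin.le_def.1 hk)
  have hbot : ∀ i : Fin n, (if (i : ℕ) < s then -H.singularValues i else 0) ≤
      hM.eigenvalues hd (Fin.natAdd n i.rev) := by
    intro i
    split_ifs with hi
    · refine le_eigenvalues_of_orthonormal_eigenvectors hM hd _ eH.orthonormal heH' hMH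
        ((Ici i).disjSum univ) (by simp; omega) ?_
      rintro (k | k) hk
      · simpa using H.singularValues_antitone (by simpa using hk : i ≤ k)
      · simpa using neg_le_iff_add_nonneg.2
          (add_nonneg (H.singularValues_nonneg _) (H.singularValues_nonneg _))
    · refine le_eigenvalues_of_orthonormal_eigenvectors hM hd _ eX.orthonormal heX hMX
        (univ.disjSum (Ici i)) (by simp; omega) ?_
      rintro (k | k) hk
      · simpa using X.singularValues_nonneg _
      · have hk' : i ≤ k := by simpa using hk
        simp [hX0 k ((not_lt.1 hi).trans hk')]
  have htr : ∑ j, hM.eigenvalues hd j = ∑ i : Fin n, (X + H).singularValues i := by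
    have h1 := (P - jordanWielandt H).trace_eq_sum_inner (hM.eigenvectorBasis hd)
    have h2 := P.trace_eq_sum_inner eC
    have h3 := (jordanWielandt H).trace_eq_sum_inner eH
    simp only [hP, heH, inner_smul_right, OrthonormalBasis.inner_eq_ite, if_true,
      Fintype.sum_sum_type, Sum.elim_inl, Sum.elim_inr] at h2 h3
    rw [map_sub, h2, h3] at h1
    simp only [hM.apply_eigenvectorBasis, inner_smul_right, OrthonormalBasis.inner_eq_ite] at h1
    simpa using h1.symm
  rw [← htr, Fin.sum_univ_add, ← Equiv.sum_comp Fin.revPerm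
    (fun i => hM.eigenvalues hd (Fin.natAdd n i)), ← sum_add_distrib]
  refine sum_le_sum fun i _ => le_trans (le_of_eq ?_) (add_le_add (htop i) (hbot i))
  split_ifs <;> ring

end SingularValueInequalities

section SparseRecovery
variable {F : Type*} [NormedAddCommGroup F] [InnerProductSpace ℝ F] {N : ℕ}

/-- A linear map with two-sided bounds on `k`-sparse vectors. -/
def SparseBounds (B : (Fin N → ℝ) →ₗ[ℝ] F) (k : ℕ) (α β : ℝ) : Prop :=
  ∀ a : Fin N → ℝ, #{i | a i ≠ 0} ≤ k →
    α ^ 2 * ∑ i, a i ^ 2 ≤ ‖B a‖ ^ 2 ∧ ‖B a‖ ^ 2 ≤ β ^ 2 * ∑ i, a i ^ 2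

lemma card_add_ne_zero_le (x y : Fin N → ℝ) :
    #{i | (x + y) i ≠ 0} ≤ #{i | x i ≠ 0} + #{i | y i ≠ 0} := by
  refine (card_le_card fun i => ?_).trans (card_union_le _ _)
  simp only [mem_filter, mem_union, mem_univ, true_and, Pi.add_apply]
  contrapose!
  rintro ⟨h1, h2⟩
  rw [h1, h2, add_zero]

lemma card_smul_ne_zero_le (p : ℝ) (x : Fin N → ℝ) : #{i | (p • x) i ≠ 0} ≤ #{i | x i ≠ 0} :=
  card_le_card fun i => by simp +contextual

/-- Almost orthogonality of the images of disjointly supported sparse vectors. -/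
lemma SparseBounds.neg_inner_le {B : (Fin N → ℝ) →ₗ[ℝ] F} {s : ℕ} {α β : ℝ}
    (hB : SparseBounds B (2 * s) α β) {x y : Fin N → ℝ} (hx : #{i | x i ≠ 0} ≤ s)
    (hy : #{i | y i ≠ 0} ≤ s) (hxy : ∀ i, x i * y i = 0) :
    -inner ℝ (B x) (B y) ≤ (β ^ 2 - α ^ 2) / 2 * (√(∑ i, x i ^ 2) * √(∑ i, y i ^ 2)) := by
  set r := √(∑ i, x i ^ 2) with hr
  set t := √(∑ i, y i ^ 2) with ht
  have hr2 : ∑ i, x i ^ 2 = r ^ 2 := (Real.sq_sqrt (sum_nonneg fun i _ => sq_nonneg _)).symm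
  have ht2 : ∑ i, y i ^ 2 = t ^ 2 := (Real.sq_sqrt (sum_nonneg fun i _ => sq_nonneg _)).symm
  have hr0 : 0 ≤ r := Real.sqrt_nonneg _
  have ht0 : 0 ≤ t := Real.sqrt_nonneg _
  have hzero : ∀ z : Fin N → ℝ, ∑ i, z i ^ 2 = 0 → z = 0 := fun z hz => by
    ext i
    simpa using (sum_eq_zero_iff_of_nonneg fun i _ => sq_nonneg (z i)).1 hz i (mem_univ i)
  rcases hr0.eq_or_lt with h | hrpos
  · simp [hzero x (by rw [hr2, ← h]; ring), ← h]
  rcases ht0.eq_or_lt with h | htpos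
  · simp [hzero y (by rw [ht2, ← h]; ring), ← h]
  have hcard : ∀ p q : ℝ, #{i | (p • x + q • y) i ≠ 0} ≤ 2 * s := fun p q => by
    refine (card_add_ne_zero_le _ _).trans ?_
    have h1 := card_smul_ne_zero_le p x
    have h2 := card_smul_ne_zero_le q y
    omega
  have hsum : ∀ p q : ℝ, ∑ i, (p • x + q • y) i ^ 2 = p ^ 2 * r ^ 2 + q ^ 2 * t ^ 2 := fun p q => by
    rw [← hr2, ← ht2, mul_sum, mul_sum, ← sum_add_distrib]
    refine sum_congr rfl fun i _ => ?_
    simp only [Pi.add_apply, Pi.smul_apply, smul_eq_mul]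
    linear_combination 2 * p * q * hxy i
  have hlow := (hB _ (hcard t r)).1
  have hupp := (hB _ (hcard t (-r))).2
  have hexp : ∀ p q : ℝ, ‖B (p • x + q • y)‖ ^ 2 =
      p ^ 2 * ‖B x‖ ^ 2 + 2 * (p * q) * inner ℝ (B x) (B y) + q ^ 2 * ‖B y‖ ^ 2 := fun p q => by
    rw [map_add, map_smul, map_smul, norm_add_sq_real, norm_smul, norm_smul, inner_smul_left,
      inner_smul_right, mul_pow, mul_pow, Real.norm_eq_abs, Real.norm_eq_abs, sq_abs, sq_abs,
      conj_trivial]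
    ring
  rw [hsum, hexp] at hlow hupp
  have hrt : 0 < r * t := mul_pos hrpos htpos
  refine le_of_mul_le_mul_left ?_ hrt
  nlinarith

/-- The restriction of `h` to the `j`-th block of `s` consecutive indices. -/
def block (h : Fin N → ℝ) (s j : ℕ) : Fin N → ℝ := fun i => if (i : ℕ) / s = j then h i else 0

lemma card_block_ne_zero_le (h : Fin N → ℝ) {s : ℕ} (hs : 0 < s) (j : ℕ) :
    #{i | block h s j i ≠ 0} ≤ s := by
  have : #{i : Fin N | block h s j i ≠ 0} ≤ #(Ico (j * s) (j * s + s)) := by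
    refine card_le_card_of_injOn (fun i => (i : ℕ)) (fun i hi => ?_) Fin.val_injective.injOn
    have hi : (i : ℕ) / s = j := by
      by_contra hc
      simp [block, hc] at hi
    simp only [coe_Ico, Set.mem_Ico, ← hi]
    have := Nat.div_add_mod (i : ℕ) s
    have := Nat.mod_lt (i : ℕ) hs
    rw [mul_comm]
    omega
  simpa using this

lemma block_mul_block (h : Fin N → ℝ) (s : ℕ) {j k : ℕ} (hjk : j ≠ k) (i : Fin N) :
    block h s j i * block h s k i = 0 := by
  unfold block
  split_ifs with h1 h2 <;> simp
  exact absurd (h1.symm.trans h2) hjk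

lemma sum_block (h : Fin N → ℝ) (s : ℕ) : ∑ j ∈ range N, block h s j = h := by
  ext i
  have : (i : ℕ) / s < N := (Nat.div_le_self _ _).trans_lt i.2
  simp [block, Finset.sum_apply, this]

/-- The `ℓ²` norm of a block is controlled by the `ℓ¹` norm of the preceding one. -/
lemma sqrt_sum_sq_block_succ_le {h : Fin N → ℝ} (hanti : Antitone h) (h0 : ∀ i, 0 ≤ h i) {s : ℕ}
    (hs : 0 < s) (j : ℕ) :
    √s * √(∑ i, block h s (j + 1) i ^ 2) ≤ ∑ i, block h s j i := by
  have hb0 : ∀ j i, 0 ≤ block h s j i := fun j i => by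
    unfold block; split_ifs <;> simp [h0]
  by_cases hN : (j + 1) * s < N
  swap
  · have : ∀ i, block h s (j + 1) i = 0 := fun i => by
      refine if_neg fun hi => hN (lt_of_le_of_lt ?_ i.2)
      rw [← hi]
      exact Nat.div_mul_le_self _ _
    simp only [this]
    simpa using sum_nonneg fun i _ => hb0 j i
  set i₀ : Fin N := ⟨(j + 1) * s, hN⟩
  have hup : ∑ i, block h s (j + 1) i ^ 2 ≤ s * h i₀ ^ 2 := by
    rw [← sum_filter_add_sum_filter_not univ (fun i => block h s (j + 1) i ≠ 0)]
    rw [sum_eq_zero (s := filter (fun i => ¬ block h s (j + 1) i ≠ 0) univ)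
      (fun i hi => by simpa using hi), add_zero]
    refine (sum_le_card_nsmul _ _ (h i₀ ^ 2) fun i hi => ?_).trans ?_
    · refine pow_le_pow_left₀ (hb0 _ i) ?_ 2
      unfold block
      split_ifs with hij
      · refine hanti (Fin.le_def.2 ?_)
        change (j + 1) * s ≤ i
        rw [← hij]
        exact Nat.div_mul_le_self _ _
      · exact h0 _
    · rw [nsmul_eq_mul]
      have := card_block_ne_zero_le h hs (j + 1)
      gcongr
  have hlo : s * h i₀ ≤ ∑ i, block h s j i := by
    have hc : #(univ.filter fun i : Fin N => (i : ℕ) / s = j) = s := by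
      have : #(univ.filter fun i : Fin N => (i : ℕ) / s = j) = #(Ico (j * s) (j * s + s)) := by
        rw [← card_map Fin.valEmbedding]
        congr 1
        ext k
        simp only [mem_map, mem_filter, mem_univ, true_and, Fin.valEmbedding_apply, mem_Ico]
        rw [← Nat.succ_mul]
        constructor
        · rintro ⟨i, rfl, rfl⟩
          exact ⟨Nat.div_mul_le_self _ _, Nat.lt_mul_of_div_lt (Nat.lt_succ_self _) hs⟩
        · rintro ⟨h1, h2⟩
          exact ⟨⟨k, h2.trans hN⟩, Nat.div_eq_of_lt_le h1 h2, rfl⟩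
      simpa using this
    have : s * h i₀ = ∑ i ∈ univ.filter (fun i : Fin N => (i : ℕ) / s = j), h i₀ := by simp [hc]
    rw [this]
    simp only [block, ← sum_filter]
    refine sum_le_sum fun i hi => hanti (Fin.le_def.2 ?_)
    change (i : ℕ) ≤ (j + 1) * s
    have hi : (i : ℕ) / s = j := by simpa using hi
    exact (Nat.lt_mul_of_div_lt (by omega) hs).le
  calc √s * √(∑ i, block h s (j + 1) i ^ 2) ≤ √s * √(s * h i₀ ^ 2) := by gcongr
    _ = s * h i₀ := by
      rw [Real.sqrt_mul (by positivity), Real.sqrt_sq (h0 _), ← mul_assoc,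
        Real.mul_self_sqrt (by positivity)]
    _ ≤ _ := hlo

/-- A nonincreasing nonnegative vector in the kernel of `B` whose tail is dominated by its head
vanishes, provided that the bounds of `B` on `2s`-sparse vectors satisfy `β² / α² < 4√2 - 3`. -/
theorem SparseBounds.eq_zero_of_tail_le_head {B : (Fin N → ℝ) →ₗ[ℝ] F} {s : ℕ} {α β : ℝ}
    (hs : 0 < s) (hα : 0 < α) (hγ : β ^ 2 / α ^ 2 < 4 * √2 - 3)
    (hB : SparseBounds B (2 * s) α β) {h : Fin N → ℝ} (hanti : Antitone h) (h0 : ∀ i, 0 ≤ h i)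
    (hBh : B h = 0)
    (htail : 0 ≤ ∑ i : Fin N, (if (i : ℕ) < s then h i else -h i)) : h = 0 := by
  have hb0 : ∀ j i, 0 ≤ block h s j i := fun j i => by
    unfold block; split_ifs <;> simp [h0]
  set ν : ℕ → ℝ := fun j => √(∑ i, block h s j i ^ 2) with hν
  have hν0 : ∀ j, 0 ≤ ν j := fun j => Real.sqrt_nonneg _
  have hνsq : ∀ j, ν j ^ 2 = ∑ i, block h s j i ^ 2 := fun j =>
    Real.sq_sqrt (sum_nonneg fun i _ => sq_nonneg _)
  set R := ∑ j ∈ Ico 2 (N + 2), ν j with hR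
  have hR0 : 0 ≤ R := sum_nonneg fun j _ => hν0 j
  -- everything beyond the first two blocks
  have hsplit : B (block h s 0) + B (block h s 1) = -∑ j ∈ Ico 2 (N + 2), B (block h s j) := by
    have : ∑ j ∈ range (N + 2), block h s j = h := by
      rw [sum_range_add, sum_block]
      simp only [add_eq_left]
      refine sum_eq_zero fun j _ => funext fun i => if_neg ?_
      have : (i : ℕ) / s < N := (Nat.div_le_self _ _).trans_lt i.2
      omega
    rw [eq_neg_iff_add_eq_zero, ← map_sum, ← map_add, ← map_add, ← hBh]
    congr 1
    conv_rhs => rw [← this, range_eq_Ico, ← sum_Ico_consecutive _ (Nat.zero_le 2) (by omega)]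
    congr 1
    simp [sum_range_succ]
  have hdis : ∀ k j, k ≠ j → -inner ℝ (B (block h s k)) (B (block h s j)) ≤
      (β ^ 2 - α ^ 2) / 2 * (ν k * ν j) := fun k j hkj =>
    hB.neg_inner_le (card_block_ne_zero_le h hs k) (card_block_ne_zero_le h hs j)
      (block_mul_block h s hkj)
  have hmain : α ^ 2 * (ν 0 ^ 2 + ν 1 ^ 2) ≤ (β ^ 2 - α ^ 2) / 2 * ((ν 0 + ν 1) * R) := by
    have hlow := (hB (block h s 0 + block h s 1) (by
      refine (card_add_ne_zero_le _ _).trans ?_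
      have := card_block_ne_zero_le h hs 0
      have := card_block_ne_zero_le h hs 1
      omega)).1
    have hsq : ∑ i, (block h s 0 + block h s 1) i ^ 2 = ν 0 ^ 2 + ν 1 ^ 2 := by
      rw [hνsq, hνsq, ← sum_add_distrib]
      refine sum_congr rfl fun i _ => ?_
      rw [Pi.add_apply]
      linear_combination 2 * block_mul_block h s zero_ne_one i
    rw [hsq] at hlow
    refine hlow.trans ?_
    have : ‖B (block h s 0 + block h s 1)‖ ^ 2 = ∑ j ∈ Ico 2 (N + 2),
        (-inner ℝ (B (block h s 0)) (B (block h s j)) +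
          -inner ℝ (B (block h s 1)) (B (block h s j))) := by
      rw [← real_inner_self_eq_norm_sq, map_add]
      nth_rewrite 2 [hsplit]
      rw [inner_neg_right, inner_sum, ← sum_neg_distrib]
      refine sum_congr rfl fun j _ => ?_
      rw [inner_add_left]; ring
    rw [this, hR, mul_sum, mul_sum]
    refine sum_le_sum fun j hj => ?_
    have hj2 := (mem_Ico.1 hj).1
    have h1 := hdis 0 j (by omega)
    have h2 := hdis 1 j (by omega)
    linarith
  set head := ∑ i, block h s 0 i with hhead
  set tail := ∑ j ∈ Ico 1 (N + 1), ∑ i, block h s j i with htl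
  have hhead0 : 0 ≤ head := sum_nonneg fun i _ => hb0 0 i
  have e1 : head + tail = ∑ i, h i := by
    have : ∑ j ∈ range (N + 1), block h s j = h := by
      rw [sum_range_succ, sum_block, add_eq_left]
      refine funext fun i => if_neg ?_
      have : (i : ℕ) / s < N := (Nat.div_le_self _ _).trans_lt i.2
      omega
    conv_rhs => rw [← this]
    simp only [Finset.sum_apply]
    rw [sum_comm, range_eq_Ico, ← sum_Ico_consecutive _ (Nat.zero_le 1) (by omega)]
    simp [hhead, htl]
  have hsum : ∑ i : Fin N, (if (i : ℕ) < s then h i else -h i) = head - tail := by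
    have e2 : ∑ i : Fin N, (if (i : ℕ) < s then h i else -h i) = 2 * head - ∑ i, h i := by
      rw [hhead, mul_sum, ← sum_sub_distrib]
      refine sum_congr rfl fun i _ => ?_
      simp only [block, Nat.div_eq_zero_iff, hs.ne', false_or]
      split_ifs <;> ring
    rw [e2, ← e1]; ring
  rw [hsum] at htail
  have hsqs : 0 < √(s : ℝ) := Real.sqrt_pos.2 (by exact_mod_cast hs)
  have hRtail : √s * R ≤ tail := by
    rw [hR, htl, mul_sum, sum_Ico_eq_sum_range, sum_Ico_eq_sum_range]
    refine sum_le_sum fun j _ => ?_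
    rw [show 2 + j = 1 + j + 1 by omega]
    exact sqrt_sum_sq_block_succ_le hanti h0 hs (1 + j)
  have hheadν : head ≤ √s * ν 0 := by
    have hcs := sq_sum_le_card_mul_sum_sq (s := univ.filter fun i => block h s 0 i ≠ 0)
      (f := block h s 0)
    rw [sum_filter_ne_zero] at hcs
    refine le_of_sq_le_sq (hcs.trans ?_) (mul_nonneg hsqs.le (hν0 0))
    rw [mul_pow, Real.sq_sqrt (Nat.cast_nonneg s), hνsq]
    have := card_block_ne_zero_le h hs 0
    refine mul_le_mul (by exact_mod_cast this) (sum_le_sum_of_subset_of_nonneg (filter_subset _ _)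
      fun i _ _ => sq_nonneg _) (sum_nonneg fun i _ => sq_nonneg _) (Nat.cast_nonneg s)
  have hs2 : √2 ^ 2 = (2 : ℝ) := Real.sq_sqrt zero_le_two
  have hs20 : 0 ≤ √2 := Real.sqrt_nonneg _
  have hγ' : β ^ 2 - α ^ 2 < 4 * (√2 - 1) * α ^ 2 := by
    rw [div_lt_iff₀ (by positivity)] at hγ
    linarith
  have hRν : R ≤ ν 0 :=
    le_of_mul_le_mul_left (hRtail.trans ((sub_nonneg.1 htail).trans hheadν)) hsqs
  have hν00 : ν 0 = 0 := by
    by_contra hne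
    have hpos : 0 < ν 0 := lt_of_le_of_ne (hν0 0) (Ne.symm hne)
    have h1 : 0 < (ν 0 + ν 1) * ν 0 := mul_pos (add_pos_of_pos_of_nonneg hpos (hν0 1)) hpos
    have h2 : (β ^ 2 - α ^ 2) / 2 * ((ν 0 + ν 1) * R) <
        2 * (√2 - 1) * α ^ 2 * ((ν 0 + ν 1) * ν 0) := by
      have hq : 0 ≤ (ν 0 + ν 1) * R := mul_nonneg (add_nonneg (hν0 0) (hν0 1)) hR0
      have hle : (ν 0 + ν 1) * R ≤ (ν 0 + ν 1) * ν 0 :=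
        mul_le_mul_of_nonneg_left hRν (add_nonneg (hν0 0) (hν0 1))
      have hsq1 : 0 < √2 - 1 := sub_pos.2 (Real.lt_sqrt_of_sq_lt (by norm_num))
      have hc : 0 < 2 * (√2 - 1) * α ^ 2 := by positivity
      rcases le_or_gt ((β ^ 2 - α ^ 2) / 2) 0 with hD | hD
      · exact (mul_nonpos_of_nonpos_of_nonneg hD hq).trans_lt (mul_pos hc h1)
      · exact (mul_le_mul_of_nonneg_left hle hD.le).trans_lt
          (mul_lt_mul_of_pos_right (by linarith) h1)
    have h3 : α ^ 2 * (ν 0 ^ 2 + ν 1 ^ 2) < α ^ 2 * (2 * (√2 - 1) * ((ν 0 + ν 1) * ν 0)) :=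
      (hmain.trans_lt h2).trans_eq (by ring)
    have h4 := lt_of_mul_lt_mul_left h3 (sq_nonneg α)
    nlinarith [sq_nonneg (ν 1 - (√2 - 1) * ν 0)]
  rw [hν00, mul_zero] at hheadν
  have hzero : ∑ i, h i = 0 :=
    le_antisymm (by linarith) (sum_nonneg fun i _ => h0 i)
  ext i
  exact (sum_eq_zero_iff_of_nonneg fun i _ => h0 i).1 hzero i (mem_univ i)

end SparseRecovery

section MatrixTransfer
variable {N : ℕ}

lemma sum_comp_singVals (X : Matrix (Fin N) (Fin N) ℝ) (f : ℝ → ℝ) :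
    ∑ i, f (singVals X i) = ∑ i : Fin N, f ((Matrix.toEuclideanLin X).singularValues i) := by
  have hL : Matrix.toEuclideanLin (X.conjTranspose * X) =
      LinearMap.adjoint (Matrix.toEuclideanLin X) ∘ₗ Matrix.toEuclideanLin X := by
    rw [← Matrix.toEuclideanLin_conjTranspose_eq_adjoint]
    ext x : 1
    simp [Matrix.toLpLin_apply]
  have heig : ∀ (T T' : EuclideanSpace ℝ (Fin N) →ₗ[ℝ] EuclideanSpace ℝ (Fin N))
      (hT : T.IsSymmetric) (hT' : T'.IsSymmetric) (hd), T = T' →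
      hT.eigenvalues (n := Fintype.card (Fin N)) hd = hT'.eigenvalues hd := by
    rintro T T' hT hT' hd rfl; rfl
  simp only [singVals, Matrix.IsHermitian.eigenvalues, Matrix.IsHermitian.eigenvalues₀,
    heig _ _ _ (LinearMap.isSymmetric_adjoint_comp_self _) _ hL, ← LinearMap.singularValues_fin]
  rw [Equiv.sum_comp (Fintype.equivOfCardEq (Fintype.card_fin _)).symm
    fun j : Fin (Fintype.card (Fin N)) => f ((Matrix.toEuclideanLin X).singularValues j)]
  exact Equiv.sum_comp (finCongr (Fintype.card_fin N))
    fun j : Fin N => f ((Matrix.toEuclideanLin X).singularValues j)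

lemma schattenNorm_one (X : Matrix (Fin N) (Fin N) ℝ) :
    schattenNorm 1 X = ∑ i : Fin N, (Matrix.toEuclideanLin X).singularValues i := by
  simpa [schattenNorm] using sum_comp_singVals X id

lemma schattenNorm_two_nonneg (X : Matrix (Fin N) (Fin N) ℝ) : 0 ≤ schattenNorm 2 X :=
  Real.rpow_nonneg (sum_nonneg fun _ _ => Real.rpow_nonneg (Real.sqrt_nonneg _) _) _

lemma schattenNorm_two_sq (X : Matrix (Fin N) (Fin N) ℝ)
    (v : OrthonormalBasis (Fin N) ℝ (EuclideanSpace ℝ (Fin N))) :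
    schattenNorm 2 X ^ 2 = ∑ i, ‖Matrix.toEuclideanLin X (v i)‖ ^ 2 := by
  set T := Matrix.toEuclideanLin X
  have htrace : ∀ w : OrthonormalBasis (Fin N) ℝ (EuclideanSpace ℝ (Fin N)),
      ∑ i, ‖T (w i)‖ ^ 2 = (LinearMap.adjoint T ∘ₗ T).trace ℝ _ := fun w => by
    rw [LinearMap.trace_eq_sum_inner _ w]
    simp [LinearMap.adjoint_inner_right]
  obtain ⟨u, w, hw, -⟩ := exists_singular_value_decomposition T finrank_euclideanSpace_fin
  have h0 : 0 ≤ ∑ i, singVals X i ^ (2 : ℝ) :=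
    sum_nonneg fun _ _ => Real.rpow_nonneg (Real.sqrt_nonneg _) _
  rw [htrace v, ← htrace w, schattenNorm, ← Real.sqrt_eq_rpow, Real.sq_sqrt h0,
    sum_comp_singVals X fun x => x ^ (2 : ℝ)]
  simp [hw, norm_smul, T]

/-- The matrix `∑ aᵢ uᵢ vᵢᵀ`, as a linear function of `a`. -/
noncomputable def diagonalIn (u v : OrthonormalBasis (Fin N) ℝ (EuclideanSpace ℝ (Fin N))) :
    (Fin N → ℝ) →ₗ[ℝ] Matrix (Fin N) (Fin N) ℝ :=
  Fintype.linearCombination ℝ fun i => Matrix.vecMulVec (u i) (v i)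

lemma toEuclideanLin_diagonalIn (u v : OrthonormalBasis (Fin N) ℝ (EuclideanSpace ℝ (Fin N)))
    (a : Fin N → ℝ) (k : Fin N) :
    Matrix.toEuclideanLin (diagonalIn u v a) (v k) = a k • u k := by
  have h : ∀ i, Matrix.toEuclideanLin (Matrix.vecMulVec (u i) (v i)) (v k) =
      if i = k then u i else 0 := fun i => by
    have := v.inner_eq_ite k i
    rw [EuclideanSpace.inner_eq_star_dotProduct] at this
    ext j
    simp only [Matrix.toLpLin_apply, Matrix.vecMulVec_mulVec]
    simp at this
    simp [this]
    aesop
  simp [diagonalIn, Fintype.linearCombination_apply, map_sum, LinearMap.sum_apply, h]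

lemma rank_diagonalIn_le (u v : OrthonormalBasis (Fin N) ℝ (EuclideanSpace ℝ (Fin N)))
    (a : Fin N → ℝ) : (diagonalIn u v a).rank ≤ #{i | a i ≠ 0} := by
  rw [Matrix.rank_eq_finrank_range_toLin _ (PiLp.basisFun 2 ℝ (Fin N))
    (PiLp.basisFun 2 ℝ (Fin N)), ← finrank_span_image_orthonormal u.orthonormal {i | a i ≠ 0}]
  refine Submodule.finrank_mono ?_
  rintro _ ⟨x, rfl⟩
  change Matrix.toEuclideanLin (diagonalIn u v a) x ∈ _
  rw [← v.sum_repr x, map_sum]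
  refine Submodule.sum_mem _ fun k _ => ?_
  rw [map_smul, toEuclideanLin_diagonalIn]
  refine Submodule.smul_mem _ _ ?_
  by_cases hk : a k = 0
  · simp [hk]
  · exact Submodule.smul_mem _ _ (Submodule.subset_span ⟨k, by simpa using hk, rfl⟩)

lemma schattenNorm_two_diagonalIn_sq
    (u v : OrthonormalBasis (Fin N) ℝ (EuclideanSpace ℝ (Fin N))) (a : Fin N → ℝ) :
    schattenNorm 2 (diagonalIn u v a) ^ 2 = ∑ i, a i ^ 2 := by
  simp [schattenNorm_two_sq _ v, toEuclideanLin_diagonalIn, norm_smul]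


end MatrixTransfer

/-- Exact recovery of rank-`s` matrices via nuclear norm minimization under the
condition `γ_{2s} < 4√2 - 3`. -/
theorem exact_recovery_nuclear_norm
    (N m s : ℕ) (hN : 0 < N) (hm : 0 < m) (hs : 0 < s)
    (A : Matrix (Fin N) (Fin N) ℝ →ₗ[ℝ] EuclideanSpace ℝ (Fin m))
    (α β : ℝ) (hαpos : 0 < α)
    -- `α` is the best lower constant for matrices of rank at most `2s`
    (hα : ∀ Z : Matrix (Fin N) (Fin N) ℝ, Z.rank ≤ 2 * s →
      α * schattenNorm 2 Z ≤ ‖A Z‖)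
    (hαbest : ∀ a : ℝ, (∀ Z : Matrix (Fin N) (Fin N) ℝ, Z.rank ≤ 2 * s →
      a * schattenNorm 2 Z ≤ ‖A Z‖) → a ≤ α)
    -- `β` is the best upper constant for matrices of rank at most `2s`
    (hβ : ∀ Z : Matrix (Fin N) (Fin N) ℝ, Z.rank ≤ 2 * s →
      ‖A Z‖ ≤ β * schattenNorm 2 Z)
    (hβbest : ∀ b : ℝ, (∀ Z : Matrix (Fin N) (Fin N) ℝ, Z.rank ≤ 2 * s →
      ‖A Z‖ ≤ b * schattenNorm 2 Z) → β ≤ b)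
    (hγcond : β ^ 2 / α ^ 2 < 4 * Real.sqrt 2 - 3)
    (X : Matrix (Fin N) (Fin N) ℝ) (hrank : X.rank ≤ s)
    (Xstar : Matrix (Fin N) (Fin N) ℝ)
    (hfeas : A Xstar = A X)
    (hmin : ∀ Z : Matrix (Fin N) (Fin N) ℝ, A Z = A X →
      schattenNorm 1 Xstar ≤ schattenNorm 1 Z) :
    Xstar = X := by
  have hNE : finrank ℝ (EuclideanSpace ℝ (Fin N)) = N := finrank_euclideanSpace_fin
  set L := Matrix.toEuclideanLin (Xstar - X) with hL
  obtain ⟨u, v, hLv, -⟩ := exists_singular_value_decomposition L hNE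
  set h : Fin N → ℝ := fun i => L.singularValues i with hh
  have hdiag : diagonalIn u v h = Xstar - X := by
    refine Matrix.toEuclideanLin.injective (v.toBasis.ext fun k => ?_)
    rw [v.coe_toBasis, toEuclideanLin_diagonalIn, ← hL, hLv]
  have hB : SparseBounds (A ∘ₗ diagonalIn u v) (2 * s) α β := fun a ha => by
    have hr := (rank_diagonalIn_le u v a).trans ha
    have h0 := schattenNorm_two_nonneg (diagonalIn u v a)
    rw [← schattenNorm_two_diagonalIn_sq u v a, ← mul_pow, ← mul_pow]
    exact ⟨pow_le_pow_left₀ (by positivity) (hα _ hr) 2,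
      pow_le_pow_left₀ (norm_nonneg _) (hβ _ hr) 2⟩
  have hrange : finrank ℝ (Matrix.toEuclideanLin X).range ≤ s := by
    rw [Matrix.rank_eq_finrank_range_toLin _ (PiLp.basisFun 2 ℝ (Fin N))
      (PiLp.basisFun 2 ℝ (Fin N))] at hrank
    exact hrank
  have htail : 0 ≤ ∑ i : Fin N, (if (i : ℕ) < s then h i else -h i) := by
    have hle := hmin X rfl
    have hpert := sum_singularValues_le_sum_singularValues_add (Matrix.toEuclideanLin X) L hNE hrange
    rw [hL, ← map_add, add_sub_cancel, ← schattenNorm_one, ← hL] at hpert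
    have := hpert.trans hle
    rw [schattenNorm_one, ← sub_nonneg, ← sum_sub_distrib] at this
    refine this.trans_eq (sum_congr rfl fun i _ => ?_)
    split_ifs with hi
    · simp [hh]
    · rw [(LinearMap.singularValues_eq_zero_iff_le_finrank_range _).2
        (hrange.trans (not_lt.1 hi)), zero_sub]
  have hzero : h = 0 := hB.eq_zero_of_tail_le_head hs hαpos hγcond
    (fun i j hij => L.singularValues_antitone (Fin.le_def.1 hij))
    (fun i => L.singularValues_nonneg i) (by simp [hdiag, hfeas]) htail
  rw [hzero, map_zero] at hdiag
  exact (sub_eq_zero.1 hdiag.symm)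
end

section
/- For every 0 < p ≤ 1 and p < q ≤ 2 there exist constants c_{p,q}, C_{p,q} > 0 such that for all positive integers N, m with 1 ≤ m < N^2, c_{p,q} · min{1, N/m}^{1/p − 1/q} ≤ d^m(B_{S_p}^N, S_q^N) ≤ C_{p,q} · min{1, N/m}^{1/p − 1/q}, where B_{S_p}^N is the unit ball of the Schatten p-quasi-norm in M_N. -/
/-- The Gelfand `m`-width of a subset `K` of the space of `N × N` real matrices, measured
in the Schatten `q`-quasi-norm: the infimum over subspaces `L` of codimension at most `m`
of `sup { ‖X‖_{S_q} : X ∈ K ∩ L }`. -/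
noncomputable def gelfandWidth {N : ℕ} (m : ℕ) (K : Set (Matrix (Fin N) (Fin N) ℝ))
    (q : ℝ) : ℝ :=
  sInf { r : ℝ | ∃ L : Submodule ℝ (Matrix (Fin N) (Fin N) ℝ),
    Module.finrank ℝ (Matrix (Fin N) (Fin N) ℝ ⧸ L) ≤ m ∧
    r = sSup (schattenNorm q '' (K ∩ (L : Set (Matrix (Fin N) (Fin N) ℝ)))) }

open scoped BigOperators

/-- Independent uniform signs factorise: the average of a product is the product of averages. -/
lemma expect_signs_prod {ι : Type*} [Fintype ι] [DecidableEq ι] (f : ι → ℤˣ → ℝ) :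
    𝔼 e : ι → ℤˣ, ∏ i, f i (e i) = ∏ i, (f i 1 + f i (-1)) / 2 := by
  rw [Fintype.expect_eq_sum_div_card, ← Fintype.prod_sum]
  simp [Finset.prod_div_distrib, UnitsInt.univ]

/-- The linear form `∑ i, e i * x i` with sign coefficients `e`. -/
def signForm {ι : Type*} [Fintype ι] (e : ι → ℤˣ) (x : ι → ℝ) : ℝ :=
  ∑ i, ((e i : ℤ) : ℝ) * x i

lemma expect_exp_signForm_le {ι : Type*} [Fintype ι] [DecidableEq ι] (x : ι → ℝ) :
    𝔼 e : ι → ℤˣ, Real.exp (signForm e x) ≤ Real.exp ((∑ i, x i ^ 2) / 2) := by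
  simp only [signForm, Real.exp_sum]
  rw [expect_signs_prod (fun i s => Real.exp (((s : ℤ) : ℝ) * x i)), Finset.sum_div, Real.exp_sum]
  refine Finset.prod_le_prod (fun i _ => by positivity) fun i _ => ?_
  have := Real.cosh_le_exp_half_sq (x i)
  rw [Real.cosh_eq] at this
  simpa using this

lemma expect_cos_signForm {ι : Type*} [Fintype ι] [DecidableEq ι] (x : ι → ℝ) :
    𝔼 e : ι → ℤˣ, Real.cos (signForm e x) = ∏ i, Real.cos (x i) := by
  have key : ∑ e : ι → ℤˣ, Complex.exp ((signForm e x : ℝ) * Complex.I) =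
      ∏ i, (2 * Complex.cos (x i)) := by
    have h1 : ∀ e : ι → ℤˣ, Complex.exp ((signForm e x : ℝ) * Complex.I) =
        ∏ i, Complex.exp (((e i : ℤ) : ℂ) * x i * Complex.I) := by
      intro e
      rw [← Complex.exp_sum, signForm]
      push_cast
      rw [Finset.sum_mul]
    simp_rw [h1]
    rw [← Fintype.prod_sum (fun i (s : ℤˣ) => Complex.exp (((s : ℤ) : ℂ) * x i * Complex.I))]
    refine Finset.prod_congr rfl fun i _ => ?_
    rw [Complex.two_cos]
    simp [UnitsInt.univ]
  have h2 := congrArg Complex.re key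
  rw [Complex.re_sum] at h2
  simp only [Complex.exp_ofReal_mul_I_re] at h2
  have h3 : (∏ i, (2 * Complex.cos (x i)) : ℂ) = ((∏ i, (2 * Real.cos (x i)) : ℝ) : ℂ) := by
    push_cast; rfl
  rw [h3, Complex.ofReal_re] at h2
  rw [Fintype.expect_eq_sum_div_card, h2, Finset.prod_mul_distrib]
  simp

/-- A Khintchine inequality between the first and the second moment. -/
lemma le_expect_abs_signForm {ι : Type*} [Fintype ι] [DecidableEq ι] (x : ι → ℝ) :
    Real.sqrt (∑ i, x i ^ 2) / 8 ≤ 𝔼 e : ι → ℤˣ, |signForm e x| := by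
  -- the normalised case
  have unit_case : ∀ y : ι → ℝ, ∑ i, y i ^ 2 = 1 → 1 / 8 ≤ 𝔼 e : ι → ℤˣ, |signForm e y| := by
    intro y hy
    have hcos : ∀ z : ℝ, 1 - Real.cos z ≤ |z| := by
      intro z
      have h1 := Real.one_sub_sq_div_two_le_cos (x := z)
      have h2 := Real.neg_one_le_cos z
      rcases le_total |z| 2 with h | h
      · nlinarith [sq_abs z, abs_nonneg z]
      · linarith
    have hle : 𝔼 e : ι → ℤˣ, (1 - Real.cos (signForm e y)) ≤ 𝔼 e : ι → ℤˣ, |signForm e y| :=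
      Finset.expect_le_expect fun e _ => hcos _
    rw [Finset.expect_sub_distrib, expect_cos_signForm, Fintype.expect_const] at hle
    have hprod : ∏ i, Real.cos (y i) ≤ Real.exp (-(1 / 5)) := by
      calc ∏ i, Real.cos (y i) ≤ ∏ i, Real.exp (-(1 / 5) * y i ^ 2) := by
            refine Finset.prod_le_prod (fun i _ => ?_) fun i _ => ?_
            all_goals
              have hi : y i ^ 2 ≤ 1 := hy ▸ Finset.single_le_sum
                (f := fun i => y i ^ 2) (fun j _ => sq_nonneg (y j)) (Finset.mem_univ i)
              have habs : |y i| ≤ 1 := (sq_le_one_iff_abs_le_one _).1 hi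
            · have := Real.one_sub_sq_div_two_le_cos (x := y i)
              linarith
            · have hpi := Real.pi_gt_three
              have hpi' := Real.pi_lt_d2
              have h1 := Real.cos_le_one_sub_mul_cos_sq (x := y i) (by linarith)
              have h2 := Real.add_one_le_exp (-(1 / 5) * y i ^ 2)
              have h3 : (1 / 5 : ℝ) ≤ 2 / Real.pi ^ 2 := by
                rw [div_le_div_iff₀ (by norm_num) (by positivity)]
                nlinarith
              nlinarith [mul_le_mul_of_nonneg_right h3 (sq_nonneg (y i))]
        _ = Real.exp (-(1 / 5)) := by
            rw [← Real.exp_sum, ← Finset.mul_sum, hy, mul_one]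
    have hexp : Real.exp (-(1 / 5)) ≤ 7 / 8 := by
      have h := Real.add_one_le_exp (1 / 5 : ℝ)
      rw [Real.exp_neg]
      calc (Real.exp (1 / 5))⁻¹ ≤ (1 / 5 + 1 : ℝ)⁻¹ := by gcongr
        _ ≤ 7 / 8 := by norm_num
    linarith
  set s := Real.sqrt (∑ i, x i ^ 2) with hs
  have hsum : 0 ≤ ∑ i, x i ^ 2 := Finset.sum_nonneg fun i _ => sq_nonneg _
  rcases (Real.sqrt_nonneg (∑ i, x i ^ 2)).eq_or_lt with h0 | h0
  · rw [hs, ← h0, zero_div]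
    exact Finset.expect_nonneg fun e _ => abs_nonneg _
  · have h := unit_case (fun i => x i / s) (by
      simp only [div_pow]
      rw [← Finset.sum_div, hs, Real.sq_sqrt hsum]
      exact div_self fun hz => by simp [hz] at h0)
    have hform : ∀ e : ι → ℤˣ, |signForm e fun i => x i / s| = |signForm e x| / s := by
      intro e
      have h : signForm e (fun i => x i / s) = signForm e x / s := by
        simp only [signForm, Finset.sum_div, mul_div_assoc]
      rw [h, abs_div, abs_of_pos (a := s) h0]
    simp only [hform, ← Finset.expect_div] at h
    rw [le_div_iff₀ h0] at h
    linarith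

lemma two_point_contraction {T : Type*} [Finite T] [Nonempty T] (g f : T → ℝ) :
    (⨆ t, (g t + |f t|)) + (⨆ t, (g t - |f t|)) ≤ (⨆ t, (g t + f t)) + ⨆ t, (g t - f t) := by
  have hp : ∀ t, g t + f t ≤ ⨆ t, (g t + f t) := fun t =>
    le_ciSup (f := fun t => g t + f t) (Set.finite_range _).bddAbove t
  have hm : ∀ t, g t - f t ≤ ⨆ t, (g t - f t) := fun t =>
    le_ciSup (f := fun t => g t - f t) (Set.finite_range _).bddAbove t
  refine add_le_of_le_sub_right (ciSup_le fun t => le_sub_comm.1 (ciSup_le fun t' => ?_))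
  rcases abs_cases (f t) with h | h <;>
    linarith [hp t, hm t, hp t', hm t', le_abs_self (f t'), neg_abs_le (f t')]

lemma expect_signs_succ {m : ℕ} (F : (Fin (m + 1) → ℤˣ) → ℝ) :
    𝔼 e, F e = 𝔼 e : Fin m → ℤˣ, (F (Fin.cons 1 e) + F (Fin.cons (-1) e)) / 2 := by
  rw [← Fintype.expect_equiv (Fin.consEquiv fun _ => ℤˣ) (fun x => F (Fin.cons x.1 x.2)) F
    (fun _ => rfl), ← Finset.univ_product_univ, Finset.expect_product, Finset.expect_comm]
  refine Finset.expect_congr rfl fun e _ => ?_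
  rw [Fintype.expect_eq_sum_div_card]
  simp [UnitsInt.univ]

/-- Contraction principle for the absolute value. -/
lemma expect_iSup_abs_le {T : Type*} [Finite T] [Nonempty T] {m : ℕ} (f : Fin m → T → ℝ)
    (g : T → ℝ) :
    𝔼 e : Fin m → ℤˣ, ⨆ t, (g t + ∑ i, ((e i : ℤ) : ℝ) * |f i t|) ≤
      𝔼 e : Fin m → ℤˣ, ⨆ t, (g t + ∑ i, ((e i : ℤ) : ℝ) * f i t) := by
  induction m generalizing g with
  | zero => simp
  | succ m ih =>
    rw [expect_signs_succ, expect_signs_succ]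
    simp only [Fin.sum_univ_succ, Fin.cons_zero, Fin.cons_succ, ← add_assoc, Units.val_one,
      Units.val_neg, Int.cast_one, Int.cast_neg, one_mul, neg_one_mul, ← sub_eq_add_neg]
    have h1 := ih (fun i => f i.succ) (fun t => g t + |f 0 t|)
    have h2 := ih (fun i => f i.succ) (fun t => g t - |f 0 t|)
    simp only [← Finset.expect_div, Finset.expect_add_distrib]
    refine div_le_div_of_nonneg_right ((add_le_add h1 h2).trans ?_) zero_le_two
    simp only [← Finset.expect_add_distrib]
    refine Finset.expect_le_expect fun e _ => ?_
    have := two_point_contraction (fun t => g t + ∑ i : Fin m, ((e i : ℤ) : ℝ) * f i.succ t) (f 0)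
    simpa only [add_right_comm, add_sub_right_comm] using this

/-- Symmetrisation: the deviation of the empirical mean of `|⟨a i, x t⟩|` from its expectation is
controlled by the supremum of the linear process. -/
lemma expect_iSup_deviation_le {T ι : Type*} [Finite T] [Nonempty T] [Fintype ι] [DecidableEq ι]
    (m : ℕ) (x : T → ι → ℝ) :
    𝔼 a : Fin m → ι → ℤˣ, (⨆ t, (m * (𝔼 b : ι → ℤˣ, |signForm b (x t)|) -
        ∑ i, |signForm (a i) (x t)|)) ≤
      2 * 𝔼 a : Fin m → ι → ℤˣ, ⨆ t, ∑ i, signForm (a i) (x t) := by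
  have bdd : ∀ F : T → ℝ, BddAbove (Set.range F) := fun F => (Set.finite_range F).bddAbove
  -- the marginals of a uniformly distributed tuple are uniform
  have marginal : ∀ (F : (ι → ℤˣ) → ℝ) (i : Fin m),
      𝔼 a : Fin m → ι → ℤˣ, F (a i) = 𝔼 b, F b := by
    intro F i
    have shift : ∀ c : ι → ℤˣ, 𝔼 a : Fin m → ι → ℤˣ, F (a i) =
        𝔼 a : Fin m → ι → ℤˣ, F (c * a i) := fun c =>
      (Fintype.expect_equiv (Equiv.mulLeft fun _ => c) (fun a => F (c * a i)) (fun a => F (a i))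
        fun a => rfl).symm
    have havg : 𝔼 a : Fin m → ι → ℤˣ, F (a i) =
        𝔼 c : ι → ℤˣ, 𝔼 a : Fin m → ι → ℤˣ, F (c * a i) := by
      rw [← Finset.expect_congr rfl fun c _ => shift c, Fintype.expect_const]
    rw [havg, Finset.expect_comm]
    have h : ∀ a : Fin m → ι → ℤˣ, 𝔼 c : ι → ℤˣ, F (c * a i) = 𝔼 b, F b := fun a =>
      Fintype.expect_equiv (Equiv.mulRight (a i)) _ _ fun c => rfl
    rw [Finset.expect_congr rfl fun a _ => h a, Fintype.expect_const]
  set V : (Fin m → ι → ℤˣ) → T → Fin m → ℝ := fun a t i => |signForm (a i) (x t)| with hV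
  have mean : ∀ t, m * (𝔼 b : ι → ℤˣ, |signForm b (x t)|) =
      𝔼 a : Fin m → ι → ℤˣ, ∑ i, V a t i := by
    intro t
    rw [Finset.expect_sum_comm, Finset.sum_congr rfl fun i _ =>
      marginal (fun b => |signForm b (x t)|) i]
    simp
  have decouple : 𝔼 a : Fin m → ι → ℤˣ, (⨆ t, (m * (𝔼 b : ι → ℤˣ, |signForm b (x t)|) -
        ∑ i, V a t i)) ≤
      𝔼 a : Fin m → ι → ℤˣ, 𝔼 a' : Fin m → ι → ℤˣ, ⨆ t, ∑ i, (V a' t i - V a t i) := by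
    refine Finset.expect_le_expect fun a _ => ciSup_le fun t => ?_
    rw [mean, ← Fintype.expect_const (ι := Fin m → ι → ℤˣ) (∑ i, V a t i),
      ← Finset.expect_sub_distrib]
    refine Finset.expect_le_expect fun a' _ => ?_
    rw [← Finset.sum_sub_distrib]
    exact le_ciSup (f := fun t => ∑ i, (V a' t i - V a t i)) (bdd _) t
  have swap : ∀ e : Fin m → ℤˣ,
      𝔼 a : Fin m → ι → ℤˣ, 𝔼 a' : Fin m → ι → ℤˣ, (⨆ t, ∑ i, (V a' t i - V a t i)) =
      𝔼 a : Fin m → ι → ℤˣ, 𝔼 a' : Fin m → ι → ℤˣ,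
        ⨆ t, ∑ i, ((e i : ℤ) : ℝ) * (V a' t i - V a t i) := by
    intro e
    let σ : (Fin m → ι → ℤˣ) × (Fin m → ι → ℤˣ) → (Fin m → ι → ℤˣ) × (Fin m → ι → ℤˣ) := fun y =>
      (fun i => if e i = 1 then y.1 i else y.2 i, fun i => if e i = 1 then y.2 i else y.1 i)
    have hσ : Function.Involutive σ := by
      intro y
      ext i : 2 <;> by_cases h : e i = 1 <;> simp [σ, h]
    rw [← Finset.expect_product' Finset.univ Finset.univ
        (fun a a' => ⨆ t, ∑ i, (V a' t i - V a t i)),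
      ← Finset.expect_product' Finset.univ Finset.univ
        (fun a a' => ⨆ t, ∑ i, ((e i : ℤ) : ℝ) * (V a' t i - V a t i)), Finset.univ_product_univ]
    refine (Fintype.expect_equiv hσ.toPerm _ _ fun y => ?_).symm
    refine iSup_congr fun t => Finset.sum_congr rfl fun i _ => ?_
    rcases Int.units_eq_one_or (e i) with h | h <;> simp [σ, h, hV]
  have symm : 𝔼 a : Fin m → ι → ℤˣ, 𝔼 a' : Fin m → ι → ℤˣ, (⨆ t, ∑ i, (V a' t i - V a t i)) ≤
      2 * 𝔼 a : Fin m → ι → ℤˣ, 𝔼 e : Fin m → ℤˣ, ⨆ t, ∑ i, ((e i : ℤ) : ℝ) * V a t i := by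
    rw [← Fintype.expect_const (ι := Fin m → ℤˣ) (𝔼 a : Fin m → ι → ℤˣ, _),
      Finset.expect_congr rfl fun e _ => swap e]
    have hneg : ∀ a : Fin m → ι → ℤˣ, 𝔼 e : Fin m → ℤˣ, (⨆ t, ∑ i, (((-e) i : ℤˣ) : ℤ) * V a t i)
        = 𝔼 e : Fin m → ℤˣ, ⨆ t, ∑ i, ((e i : ℤ) : ℝ) * V a t i := fun a =>
      Fintype.expect_equiv (Equiv.neg _) _ _ fun e => rfl
    calc _ ≤ 𝔼 e : Fin m → ℤˣ, 𝔼 a : Fin m → ι → ℤˣ, 𝔼 a' : Fin m → ι → ℤˣ,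
          ((⨆ t, ∑ i, ((e i : ℤ) : ℝ) * V a' t i) +
            ⨆ t, ∑ i, (((-e) i : ℤˣ) : ℤ) * V a t i) := by
          refine Finset.expect_le_expect fun e _ => Finset.expect_le_expect fun a _ =>
            Finset.expect_le_expect fun a' _ => ciSup_le fun t => ?_
          refine le_trans (le_of_eq ?_) (add_le_add
            (le_ciSup (f := fun t => ∑ i, ((e i : ℤ) : ℝ) * V a' t i) (bdd _) t)
            (le_ciSup (f := fun t => ∑ i, (((-e) i : ℤˣ) : ℤ) * V a t i) (bdd _) t))
          rw [← Finset.sum_add_distrib]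
          refine Finset.sum_congr rfl fun i _ => ?_
          simp only [Pi.neg_apply, Units.val_neg, Int.cast_neg]
          ring
      _ = _ := by
          simp only [Finset.expect_add_distrib, Fintype.expect_const]
          rw [two_mul, Finset.expect_comm, Finset.expect_comm (s := Finset.univ (α := Fin m → ℤˣ))]
          simp only [hneg]
  have contract : 𝔼 a : Fin m → ι → ℤˣ, 𝔼 e : Fin m → ℤˣ,
        (⨆ t, ∑ i, ((e i : ℤ) : ℝ) * V a t i) ≤
      𝔼 a : Fin m → ι → ℤˣ, 𝔼 e : Fin m → ℤˣ,
        ⨆ t, ∑ i, ((e i : ℤ) : ℝ) * signForm (a i) (x t) := by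
    refine Finset.expect_le_expect fun a _ => ?_
    simpa using expect_iSup_abs_le (fun i t => signForm (a i) (x t)) 0
  have absorb : 𝔼 a : Fin m → ι → ℤˣ, 𝔼 e : Fin m → ℤˣ,
        (⨆ t, ∑ i, ((e i : ℤ) : ℝ) * signForm (a i) (x t)) =
      𝔼 a : Fin m → ι → ℤˣ, ⨆ t, ∑ i, signForm (a i) (x t) := by
    rw [Finset.expect_comm]
    have h : ∀ e : Fin m → ℤˣ, 𝔼 a : Fin m → ι → ℤˣ,
        (⨆ t, ∑ i, ((e i : ℤ) : ℝ) * signForm (a i) (x t)) =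
        𝔼 a : Fin m → ι → ℤˣ, ⨆ t, ∑ i, signForm (a i) (x t) := by
      intro e
      refine Fintype.expect_equiv (Equiv.mulLeft fun i _ => e i) _ _ fun a => ?_
      refine iSup_congr fun t => Finset.sum_congr rfl fun i _ => ?_
      simp only [signForm, Finset.mul_sum, Equiv.coe_mulLeft, Pi.mul_apply, Units.val_mul,
        Int.cast_mul, mul_assoc]
    rw [Finset.expect_congr rfl fun e _ => h e, Fintype.expect_const]
  exact (decouple.trans symm).trans
    (mul_le_mul_of_nonneg_left (contract.trans_eq absorb) zero_le_two)

lemma sum_Icc_half_pow_natAbs_le (R : ℕ) :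
    ∑ k ∈ Finset.Icc (-(R : ℤ)) R, (1 / 2 : ℝ) ^ k.natAbs ≤ 3 - 2 * (1 / 2) ^ R := by
  induction R with
  | zero => norm_num
  | succ R ih =>
    have hset : Finset.Icc (-((R + 1 : ℕ) : ℤ)) ((R + 1 : ℕ) : ℤ) =
        insert (-((R : ℤ) + 1)) (insert ((R : ℤ) + 1) (Finset.Icc (-(R : ℤ)) R)) := by
      ext k
      simp only [Finset.mem_insert, Finset.mem_Icc]
      push_cast
      omega
    rw [hset, Finset.sum_insert (by simp; omega), Finset.sum_insert (by simp)]
    have h1 : (-((R : ℤ) + 1)).natAbs = R + 1 := by omega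
    have h2 : ((R : ℤ) + 1).natAbs = R + 1 := by omega
    rw [h1, h2, pow_succ]
    linarith

/-- The integer points of the Euclidean ball of radius `2 √N` in `ℝ ^ N`. -/
noncomputable def latticeBall (N : ℕ) : Finset (Fin N → ℤ) :=
  (Fintype.piFinset fun _ => Finset.Icc (-((4 * N : ℕ) : ℤ)) ((4 * N : ℕ) : ℤ)).filter
    fun k => ∑ i, k i ^ 2 ≤ 4 * N

lemma mem_latticeBall {N : ℕ} {k : Fin N → ℤ} : k ∈ latticeBall N ↔ ∑ i, k i ^ 2 ≤ 4 * N := by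
  simp only [latticeBall, Finset.mem_filter, Fintype.mem_piFinset, Finset.mem_Icc,
    and_iff_right_iff_imp]
  intro h i
  have hi : k i ^ 2 ≤ 4 * N := (Finset.single_le_sum (f := fun i => k i ^ 2)
    (fun j _ => sq_nonneg (k j)) (Finset.mem_univ i)).trans h
  have h1 : k i ≤ k i ^ 2 := Int.le_self_sq _
  have h2 : -k i ≤ (-k i) ^ 2 := Int.le_self_sq _
  push_cast
  constructor <;> nlinarith

lemma card_latticeBall_le (N : ℕ) : ((latticeBall N).card : ℝ) ≤ Real.exp (4 * N) := by
  have hpt : ∀ k ∈ latticeBall N, (1 : ℝ) ≤ 16 ^ N * ∏ i, (1 / 2 : ℝ) ^ (k i).natAbs := by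
    intro k hk
    rw [mem_latticeBall] at hk
    have hsum : ∑ i, (k i).natAbs ≤ 4 * N := by
      zify
      refine le_trans (Finset.sum_le_sum fun i _ => ?_) hk
      rw [← sq_abs]
      exact Int.le_self_sq _
    rw [Finset.prod_pow_eq_pow_sum, div_pow, one_pow, mul_one_div, le_div_iff₀ (by positivity),
      one_mul]
    calc (2 : ℝ) ^ ∑ i, (k i).natAbs ≤ 2 ^ (4 * N) := pow_le_pow_right₀ one_le_two hsum
      _ = 16 ^ N := by rw [pow_mul]; norm_num
  have h48 : (48 : ℝ) ≤ Real.exp 4 := by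
    have h : (2.7 : ℝ) ^ 4 ≤ Real.exp 1 ^ 4 := by
      gcongr
      linarith [Real.exp_one_gt_d9]
    rw [← Real.exp_nat_mul] at h
    norm_num at h ⊢
    linarith
  calc ((latticeBall N).card : ℝ) = ∑ k ∈ latticeBall N, (1 : ℝ) := by simp
    _ ≤ ∑ k ∈ latticeBall N, 16 ^ N * ∏ i, (1 / 2 : ℝ) ^ (k i).natAbs := Finset.sum_le_sum hpt
    _ ≤ ∑ k ∈ Fintype.piFinset fun _ => Finset.Icc (-((4 * N : ℕ) : ℤ)) ((4 * N : ℕ) : ℤ),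
          16 ^ N * ∏ i : Fin N, (1 / 2 : ℝ) ^ (k i).natAbs :=
        Finset.sum_le_sum_of_subset_of_nonneg (Finset.filter_subset _ _)
          fun k _ _ => by positivity
    _ = 16 ^ N * ∏ _i : Fin N, ∑ k ∈ Finset.Icc (-((4 * N : ℕ) : ℤ)) ((4 * N : ℕ) : ℤ),
          (1 / 2 : ℝ) ^ k.natAbs := by rw [← Finset.mul_sum, Finset.prod_univ_sum]
    _ ≤ 16 ^ N * ∏ _i : Fin N, (3 : ℝ) := by
        gcongr
        refine (sum_Icc_half_pow_natAbs_le (4 * N)).trans ?_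
        have : (0 : ℝ) ≤ 2 * (1 / 2) ^ (4 * N) := by positivity
        linarith
    _ = 48 ^ N := by
        rw [Finset.prod_const, Finset.card_univ, Fintype.card_fin, ← mul_pow]
        norm_num
    _ ≤ Real.exp 4 ^ N := by gcongr
    _ = Real.exp (4 * N) := by rw [← Real.exp_nat_mul, mul_comm]

/-- A linear form on the ball of radius `√N` is dominated by its values at lattice points. -/
lemma exists_latticeBall_ge {N : ℕ} (f y : Fin N → ℝ) (hy : ∑ i, y i ^ 2 ≤ N) :
    ∃ k ∈ latticeBall N, ∑ i, f i * y i ≤ ∑ i, f i * k i := by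
  let k : Fin N → ℤ := fun i => if 0 ≤ f i then ⌈y i⌉ else ⌊y i⌋
  have hk : ∀ i, f i * y i ≤ f i * k i ∧ (k i : ℝ) ^ 2 ≤ 2 * y i ^ 2 + 2 := by
    intro i
    by_cases hi : 0 ≤ f i
    · have hki : k i = ⌈y i⌉ := if_pos hi
      have h1 := Int.le_ceil (y i)
      have h2 := Int.ceil_lt_add_one (y i)
      rw [hki]
      refine ⟨mul_le_mul_of_nonneg_left h1 hi, ?_⟩
      nlinarith [sq_nonneg ((⌈y i⌉ : ℝ) - 2 * y i)]
    · have hki : k i = ⌊y i⌋ := if_neg hi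
      have h1 := Int.floor_le (y i)
      have h2 := Int.lt_floor_add_one (y i)
      rw [hki]
      refine ⟨mul_le_mul_of_nonpos_left h1 (le_of_not_ge hi), ?_⟩
      nlinarith [sq_nonneg ((⌊y i⌋ : ℝ) - 2 * y i)]
  refine ⟨k, mem_latticeBall.2 ?_, Finset.sum_le_sum fun i _ => (hk i).1⟩
  have h : ∑ i, (k i : ℝ) ^ 2 ≤ ∑ i, (2 * y i ^ 2 + 2) := Finset.sum_le_sum fun i _ => (hk i).2
  rw [Finset.sum_add_distrib, ← Finset.mul_sum] at h
  simp only [Finset.sum_const, Finset.card_univ, Fintype.card_fin, nsmul_eq_mul] at h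
  have hsum : ∑ i, (k i : ℝ) ^ 2 ≤ 4 * N := by linarith
  exact_mod_cast hsum

/-- The bilinear form with coefficients `S` has norm at most `M` on Euclidean space. -/
def BilinBound {N : ℕ} (S : Fin N → Fin N → ℝ) (M : ℝ) : Prop :=
  ∀ u v : Fin N → ℝ,
    ∑ j, ∑ l, S j l * (u j * v l) ≤ M * (Real.sqrt (∑ j, u j ^ 2) * Real.sqrt (∑ l, v l ^ 2))

/-- Lattice points suffice to bound the norm of a bilinear form. -/
lemma bilinBound_of_latticeBall {N : ℕ} (hN : 0 < N) (S : Fin N → Fin N → ℝ) (M : ℝ)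
    (h : ∀ k ∈ latticeBall N, ∀ l ∈ latticeBall N,
      ∑ i, ∑ j, S i j * ((k i : ℝ) * l j) ≤ N * M) : BilinBound S M := by
  have hN' : (0 : ℝ) < N := Nat.cast_pos.2 hN
  have ball_case : ∀ u v : Fin N → ℝ, ∑ j, u j ^ 2 ≤ N → ∑ j, v j ^ 2 ≤ N →
      ∑ i, ∑ j, S i j * (u i * v j) ≤ N * M := by
    intro u v hu hv
    obtain ⟨k, hk, hk'⟩ := exists_latticeBall_ge (fun i => ∑ j, S i j * v j) u hu
    obtain ⟨l, hl, hl'⟩ := exists_latticeBall_ge (fun j => ∑ i, S i j * k i) v hv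
    calc ∑ i, ∑ j, S i j * (u i * v j) = ∑ i, (∑ j, S i j * v j) * u i := by
          refine Finset.sum_congr rfl fun i _ => ?_
          rw [Finset.sum_mul]
          exact Finset.sum_congr rfl fun j _ => by ring
      _ ≤ ∑ i, (∑ j, S i j * v j) * k i := hk'
      _ = ∑ j, (∑ i, S i j * k i) * v j := by
          simp only [Finset.sum_mul]
          rw [Finset.sum_comm]
          exact Finset.sum_congr rfl fun j _ => Finset.sum_congr rfl fun i _ => by ring
      _ ≤ ∑ j, (∑ i, S i j * k i) * l j := hl'
      _ = ∑ i, ∑ j, S i j * ((k i : ℝ) * l j) := by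
          simp only [Finset.sum_mul]
          rw [Finset.sum_comm]
          exact Finset.sum_congr rfl fun j _ => Finset.sum_congr rfl fun i _ => by ring
      _ ≤ N * M := h k hk l hl
  intro u v
  set a := Real.sqrt (∑ j, u j ^ 2) with ha
  set b := Real.sqrt (∑ j, v j ^ 2) with hb
  have sq_a : a ^ 2 = ∑ j, u j ^ 2 := Real.sq_sqrt (Finset.sum_nonneg fun _ _ => sq_nonneg _)
  have sq_b : b ^ 2 = ∑ j, v j ^ 2 := Real.sq_sqrt (Finset.sum_nonneg fun _ _ => sq_nonneg _)
  have vanish : ∀ w : Fin N → ℝ, Real.sqrt (∑ j, w j ^ 2) = 0 → ∀ j, w j = 0 := by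
    intro w hw j
    rw [Real.sqrt_eq_zero (Finset.sum_nonneg fun _ _ => sq_nonneg _),
      Finset.sum_eq_zero_iff_of_nonneg fun _ _ => sq_nonneg _] at hw
    simpa using hw j (Finset.mem_univ j)
  rcases (Real.sqrt_nonneg (∑ j, u j ^ 2)).eq_or_lt with ha0 | ha0
  · simp [vanish u ha0.symm, ha]
  rcases (Real.sqrt_nonneg (∑ j, v j ^ 2)).eq_or_lt with hb0 | hb0
  · simp [vanish v hb0.symm, hb]
  rw [← ha] at ha0
  rw [← hb] at hb0
  set s := Real.sqrt N with hs
  have sq_s : s ^ 2 = N := Real.sq_sqrt hN'.le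
  have key := ball_case (fun j => s / a * u j) (fun j => s / b * v j)
    (le_of_eq (by
      simp only [mul_pow, div_pow]
      rw [← Finset.mul_sum, ← sq_a, sq_s, div_mul_cancel₀ _ (pow_pos ha0 2).ne']))
    (le_of_eq (by
      simp only [mul_pow, div_pow]
      rw [← Finset.mul_sum, ← sq_b, sq_s, div_mul_cancel₀ _ (pow_pos hb0 2).ne']))
  have hscale : ∑ i, ∑ j, S i j * ((s / a * u i) * (s / b * v j)) =
      N / (a * b) * ∑ i, ∑ j, S i j * (u i * v j) := by
    simp only [Finset.mul_sum]
    refine Finset.sum_congr rfl fun i _ => Finset.sum_congr rfl fun j _ => ?_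
    rw [← sq_s]
    field_simp
  rw [hscale, div_mul_eq_mul_div, div_le_iff₀ (mul_pos ha0 hb0), mul_assoc] at key
  exact le_of_mul_le_mul_left key (Nat.cast_pos.2 hN)

/-- The supremum of the sign process over matrices of nuclear norm at most `κ`. -/
lemma expect_iSup_signForm_le {T : Type*} [Finite T] [Nonempty T] {N m : ℕ} (hN : 0 < N)
    (hm : 0 < m) (x : T → Fin N × Fin N → ℝ) (κ : ℝ) (hκ : 0 ≤ κ)
    (hx : ∀ t S M, 0 ≤ M → BilinBound S M → ∑ j, ∑ l, S j l * x t (j, l) ≤ κ * M) :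
    𝔼 a : Fin m → Fin N × Fin N → ℤˣ, (⨆ t, ∑ i, signForm (a i) (x t)) ≤
      κ * (16 * (Real.sqrt N * Real.sqrt m)) := by
  have hN' : (0 : ℝ) < N := Nat.cast_pos.2 hN
  have hm' : (0 : ℝ) < m := Nat.cast_pos.2 hm
  set W := latticeBall N with hW
  set lam : ℝ := Real.sqrt N / Real.sqrt m with hlam
  have lam_pos : 0 < lam := by positivity
  have lam_sq : lam ^ 2 * m = N := by
    rw [hlam, div_pow, Real.sq_sqrt hN'.le, Real.sq_sqrt hm'.le]
    field_simp
  let S : (Fin m → Fin N × Fin N → ℤˣ) → Fin N → Fin N → ℝ := fun a j l =>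
    ∑ i, ((a i (j, l) : ℤ) : ℝ)
  let B : (Fin m → Fin N × Fin N → ℤˣ) → (Fin N → ℤ) → (Fin N → ℤ) → ℝ := fun a k l =>
    ∑ i, ∑ j, S a i j * ((k i : ℝ) * l j)
  let Z : (Fin m → Fin N × Fin N → ℤˣ) → ℝ := fun a =>
    ∑ k ∈ W, ∑ l ∈ W, Real.exp (lam / N * B a k l)
  have le_Z : ∀ a, ∀ k ∈ W, ∀ l ∈ W, Real.exp (lam / N * B a k l) ≤ Z a := by
    intro a k hk l hl
    refine le_trans ?_ (Finset.single_le_sum (f := fun k => ∑ l ∈ W, Real.exp (lam / N * B a k l))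
      (fun k _ => Finset.sum_nonneg fun l _ => (Real.exp_pos _).le) hk)
    exact Finset.single_le_sum (f := fun l => Real.exp (lam / N * B a k l))
      (fun l _ => (Real.exp_pos _).le) hl
  have one_le_Z : ∀ a, 1 ≤ Z a := by
    intro a
    have h0 : (0 : Fin N → ℤ) ∈ W := mem_latticeBall.2 (by simp)
    simpa [B] using le_Z a 0 h0 0 h0
  have Z_pos : ∀ a, 0 < Z a := fun a => zero_lt_one.trans_le (one_le_Z a)
  -- the maximal operator norm is at most the logarithm of the partition function
  have sup_le : ∀ a, (⨆ t, ∑ i, signForm (a i) (x t)) ≤ κ * (Real.log (Z a) / lam) := by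
    intro a
    refine ciSup_le fun t => ?_
    have hform : ∑ i, signForm (a i) (x t) = ∑ j, ∑ l, S a j l * x t (j, l) := by
      simp only [signForm, S, Finset.sum_mul]
      rw [Finset.sum_comm, Fintype.sum_prod_type]
    rw [hform]
    refine hx t _ _ (div_nonneg (Real.log_nonneg (one_le_Z a)) lam_pos.le)
      (bilinBound_of_latticeBall hN _ _ fun k hk l hl => ?_)
    have h := (Real.le_log_iff_exp_le (Z_pos a)).2 (le_Z a k hk l hl)
    rw [div_mul_eq_mul_div, div_le_iff₀ hN'] at h
    rw [mul_div_assoc', le_div_iff₀ lam_pos]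
    change B a k l * lam ≤ _
    linarith
  have expect_exp : ∀ k ∈ W, ∀ l ∈ W,
      𝔼 a : Fin m → Fin N × Fin N → ℤˣ, Real.exp (lam / N * B a k l) ≤ Real.exp (8 * N) := by
    intro k hk l hl
    let y : Fin m × (Fin N × Fin N) → ℝ := fun z => lam / N * ((k z.2.1 : ℝ) * l z.2.2)
    have hB : ∀ a : Fin m → Fin N × Fin N → ℤˣ,
        lam / N * B a k l = signForm ((Equiv.curry _ _ _).symm a) y := by
      intro a
      simp only [signForm, B, S, y, Equiv.curry_symm_apply, Function.uncurry, Finset.sum_mul,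
        Finset.mul_sum, Fintype.sum_prod_type]
      conv_rhs => rw [Finset.sum_comm]
      refine Finset.sum_congr rfl fun i _ => ?_
      conv_rhs => rw [Finset.sum_comm]
      exact Finset.sum_congr rfl fun j _ => Finset.sum_congr rfl fun z _ => by ring
    have hexp := expect_exp_signForm_le y
    rw [← Fintype.expect_equiv (Equiv.curry (Fin m) (Fin N × Fin N) ℤˣ).symm
      (fun a => Real.exp (lam / N * B a k l)) (fun e => Real.exp (signForm e y))
      fun a => by rw [hB]] at hexp
    refine hexp.trans (Real.exp_le_exp.2 ?_)
    have hy : ∑ z, y z ^ 2 = m * (lam / N) ^ 2 * ((∑ i, (k i : ℝ) ^ 2) * ∑ i, (l i : ℝ) ^ 2) := by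
      simp only [y, Fintype.sum_prod_type, mul_pow, ← Finset.mul_sum, ← Finset.sum_mul,
        Finset.sum_const, Finset.card_univ, Fintype.card_fin, nsmul_eq_mul]
      ring
    have hk' : ∑ i, (k i : ℝ) ^ 2 ≤ 4 * N := by exact_mod_cast mem_latticeBall.1 hk
    have hl' : ∑ i, (l i : ℝ) ^ 2 ≤ 4 * N := by exact_mod_cast mem_latticeBall.1 hl
    have hkl : (∑ i, (k i : ℝ) ^ 2) * ∑ i, (l i : ℝ) ^ 2 ≤ (4 * N) * (4 * N) :=
      mul_le_mul hk' hl' (Finset.sum_nonneg fun _ _ => sq_nonneg _) (by positivity)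
    rw [hy]
    calc _ ≤ m * (lam / N) ^ 2 * ((4 * N) * (4 * N)) / 2 := by gcongr
      _ = 8 * (lam ^ 2 * m) := by field_simp; ring
      _ = 8 * N := by rw [lam_sq]
  have expect_Z : 𝔼 a, Z a ≤ Real.exp (16 * N) := by
    calc 𝔼 a, Z a = ∑ k ∈ W, ∑ l ∈ W,
          𝔼 a : Fin m → Fin N × Fin N → ℤˣ, Real.exp (lam / N * B a k l) := by
          simp only [Z, Finset.expect_sum_comm]
      _ ≤ ∑ k ∈ W, ∑ l ∈ W, Real.exp (8 * N) :=
          Finset.sum_le_sum fun k hk => Finset.sum_le_sum fun l hl => expect_exp k hk l hl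
      _ = W.card * (W.card * Real.exp (8 * N)) := by simp
      _ ≤ Real.exp (4 * N) * (Real.exp (4 * N) * Real.exp (8 * N)) := by
          have := card_latticeBall_le N
          gcongr
      _ = Real.exp (16 * N) := by
          rw [← Real.exp_add, ← Real.exp_add]
          ring_nf
  have log_le : ∀ a, Real.log (Z a) ≤ 16 * N - 1 + Z a / Real.exp (16 * N) := by
    intro a
    have h := Real.log_le_sub_one_of_pos (div_pos (Z_pos a) (Real.exp_pos (16 * N)))
    rw [Real.log_div (Z_pos a).ne' (Real.exp_pos _).ne', Real.log_exp] at h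
    linarith
  have expect_log : 𝔼 a, Real.log (Z a) ≤ 16 * N := by
    refine (Finset.expect_le_expect fun a _ => log_le a).trans ?_
    rw [Finset.expect_add_distrib, Fintype.expect_const, ← Finset.expect_div]
    have := (div_le_one (Real.exp_pos _)).2 expect_Z
    linarith
  refine (Finset.expect_le_expect fun a _ => sup_le a).trans ?_
  rw [← Finset.mul_expect, ← Finset.expect_div]
  refine mul_le_mul_of_nonneg_left ?_ hκ
  rw [div_le_iff₀ lam_pos]
  refine expect_log.trans (le_of_eq ?_)
  rw [hlam]
  have h1 := Real.sq_sqrt hN'.le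
  field_simp
  linarith

/-- A random choice of `m` sign matrices: on their common kernel the Frobenius norm is at most a
multiple of `√(N / m)` times any functional dual to the operator norm. -/
lemma exists_signs_frobenius_le {N m : ℕ} (hN : 0 < N) (hm : 0 < m)
    (nuc : (Fin N × Fin N → ℝ) → ℝ) (nuc_nonneg : ∀ x, 0 ≤ nuc x)
    (hnuc : ∀ x S M, BilinBound S M → ∑ j, ∑ l, S j l * x (j, l) ≤ M * nuc x) :
    ∃ a : Fin m → Fin N × Fin N → ℤˣ, ∀ x, (∀ i, signForm (a i) x = 0) →
      Real.sqrt (∑ z, x z ^ 2) ≤ 256 * (Real.sqrt N / Real.sqrt m) * nuc x := by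
  by_contra! hcon
  choose x hker hlt using hcon
  have hN' : (0 : ℝ) < Real.sqrt N := Real.sqrt_pos.2 (Nat.cast_pos.2 hN)
  have hm' : (0 : ℝ) < Real.sqrt m := Real.sqrt_pos.2 (Nat.cast_pos.2 hm)
  have sq_m : Real.sqrt m ^ 2 = m := Real.sq_sqrt (Nat.cast_nonneg m)
  set F : (Fin m → Fin N × Fin N → ℤˣ) → ℝ := fun a => Real.sqrt (∑ z, x a z ^ 2) with hF
  have F_pos : ∀ a, 0 < F a := fun a =>
    lt_of_le_of_lt (by have := nuc_nonneg (x a); positivity) (hlt a)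
  let y : (Fin m → Fin N × Fin N → ℤˣ) → Fin N × Fin N → ℝ := fun a z => x a z / F a
  have y_norm : ∀ a, Real.sqrt (∑ z, y a z ^ 2) = 1 := by
    intro a
    simp only [y, div_pow]
    rw [← Finset.sum_div, Real.sqrt_div' _ (sq_nonneg _), Real.sqrt_sq (F_pos a).le]
    exact div_self (F_pos a).ne'
  obtain ⟨b, hb⟩ := Finite.exists_max fun a => nuc (x a) / F a
  set κ := nuc (x b) / F b with hκ
  have κ_nonneg : 0 ≤ κ := div_nonneg (nuc_nonneg _) (F_pos b).le
  have κ_lt : 256 * (Real.sqrt N / Real.sqrt m) * κ < 1 := by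
    rw [hκ, mul_div_assoc', div_lt_one (F_pos b)]
    exact hlt b
  have upper := expect_iSup_signForm_le hN hm y κ κ_nonneg (by
    intro a S M hM hS
    have h := div_le_div_of_nonneg_right (hnuc (x a) S M hS) (F_pos a).le
    simp only [y, mul_div_assoc', ← Finset.sum_div]
    refine h.trans ?_
    rw [mul_div_assoc, mul_comm]
    exact mul_le_mul_of_nonneg_right (hb a) hM)
  have dev := expect_iSup_deviation_le m y
  have lower : (m : ℝ) / 8 ≤ 𝔼 a : Fin m → Fin N × Fin N → ℤˣ,
      (⨆ t, (m * (𝔼 b : Fin N × Fin N → ℤˣ, |signForm b (y t)|) -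
        ∑ i, |signForm (a i) (y t)|)) := by
    rw [← Fintype.expect_const (ι := Fin m → Fin N × Fin N → ℤˣ) ((m : ℝ) / 8)]
    refine Finset.expect_le_expect fun a _ => ?_
    refine le_trans ?_ (le_ciSup (f := fun t => (m : ℝ) *
      (𝔼 b : Fin N × Fin N → ℤˣ, |signForm b (y t)|) - ∑ i, |signForm (a i) (y t)|)
      (Set.finite_range _).bddAbove a)
    have hzero : ∀ i, signForm (a i) (y a) = 0 := by
      intro i
      have h := hker a i
      simp only [signForm] at h
      simp only [signForm, y, mul_div_assoc', ← Finset.sum_div, h, zero_div]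
    have hkh := le_expect_abs_signForm (y a)
    rw [y_norm] at hkh
    simp only [hzero, abs_zero, Finset.sum_const_zero, sub_zero]
    calc (m : ℝ) / 8 = m * (1 / 8) := by ring
      _ ≤ _ := by gcongr
  have hfin : (m : ℝ) / 8 ≤ 2 * (κ * (16 * (Real.sqrt N * Real.sqrt m))) :=
    lower.trans (dev.trans (mul_le_mul_of_nonneg_left upper zero_le_two))
  have hfin' : 256 * (Real.sqrt N / Real.sqrt m) * κ * m =
      256 * κ * (Real.sqrt N * Real.sqrt m) := by
    rw [← sq_m, Real.sqrt_sq hm'.le]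
    field_simp
  have hm0 : (0 : ℝ) < m := Nat.cast_pos.2 hm
  nlinarith [mul_lt_mul_of_pos_right κ_lt hm0]

section Schatten

open Matrix

variable {N : ℕ}

lemma singVals_nonneg (X : Matrix (Fin N) (Fin N) ℝ) (i : Fin N) : 0 ≤ singVals X i :=
  Real.sqrt_nonneg _

lemma singVals_sq (X : Matrix (Fin N) (Fin N) ℝ) (i : Fin N) :
    singVals X i ^ 2 = (isHermitian_conjTranspose_mul_self X).eigenvalues i :=
  Real.sq_sqrt ((posSemidef_conjTranspose_mul_self X).eigenvalues_nonneg i)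

lemma sum_singVals_sq (X : Matrix (Fin N) (Fin N) ℝ) :
    ∑ i, singVals X i ^ 2 = ∑ j, ∑ l, X j l ^ 2 := by
  have h := (isHermitian_conjTranspose_mul_self X).trace_eq_sum_eigenvalues
  simp only [singVals_sq]
  rw [Finset.sum_comm]
  simpa [trace, mul_apply, sq] using h.symm

/-- Duality between the nuclear norm and the operator norm. -/
lemma sum_mul_le_of_bilinBound (X : Matrix (Fin N) (Fin N) ℝ) (S : Fin N → Fin N → ℝ) (M : ℝ)
    (hS : BilinBound S M) : ∑ j, ∑ l, S j l * X j l ≤ M * ∑ i, singVals X i := by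
  set hA := isHermitian_conjTranspose_mul_self X
  let v : Fin N → Fin N → ℝ := fun i => ⇑(hA.eigenvectorBasis i)
  have v_resolution : ∀ l l', ∑ i, v i l * v i l' = if l = l' then 1 else 0 := by
    intro l l'
    have h := congrFun (congrFun (Unitary.coe_mul_star_self hA.eigenvectorUnitary) l) l'
    simpa [v, mul_apply, one_apply, star_apply] using h
  have v_norm : ∀ i, ∑ l, v i l ^ 2 = 1 := by
    intro i
    have h := hA.eigenvectorBasis.orthonormal.1 i
    rw [EuclideanSpace.norm_eq, Real.sqrt_eq_one] at h
    simpa [v] using h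
  have Xv_norm : ∀ i, ∑ j, (X *ᵥ v i) j ^ 2 = singVals X i ^ 2 := by
    intro i
    rw [singVals_sq]
    have h1 : (Xᴴ * X) *ᵥ v i = hA.eigenvalues i • v i := hA.mulVec_eigenvectorBasis i
    have h2 : v i ⬝ᵥ v i = 1 := by
      rw [← v_norm i]
      simp [dotProduct, sq]
    calc ∑ j, (X *ᵥ v i) j ^ 2 = (X *ᵥ v i) ⬝ᵥ (X *ᵥ v i) := by simp [dotProduct, sq]
      _ = v i ⬝ᵥ ((Xᴴ * X) *ᵥ v i) := by
          rw [conjTranspose_eq_transpose_of_trivial, ← mulVec_mulVec, dotProduct_mulVec (v i),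
            vecMul_transpose]
      _ = hA.eigenvalues i := by rw [h1, dotProduct_smul, h2, smul_eq_mul, mul_one]
  have expand : ∀ j l, X j l = ∑ i, (X *ᵥ v i) j * v i l := by
    intro j l
    simp only [mulVec, dotProduct, Finset.sum_mul]
    rw [Finset.sum_comm]
    simp only [mul_assoc, ← Finset.mul_sum, v_resolution]
    simp
  calc ∑ j, ∑ l, S j l * X j l = ∑ i, ∑ j, ∑ l, S j l * ((X *ᵥ v i) j * v i l) := by
        conv_rhs => rw [Finset.sum_comm]
        refine Finset.sum_congr rfl fun j _ => ?_
        conv_rhs => rw [Finset.sum_comm]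
        refine Finset.sum_congr rfl fun l _ => ?_
        rw [expand j l, Finset.mul_sum]
    _ ≤ ∑ i, M * singVals X i := by
        refine Finset.sum_le_sum fun i _ => (hS (X *ᵥ v i) (v i)).trans_eq ?_
        rw [Xv_norm, v_norm, Real.sqrt_sq (singVals_nonneg X i), Real.sqrt_one, mul_one]
    _ = M * ∑ i, singVals X i := by rw [Finset.mul_sum]

/-- Sums over the singular values are absolutely homogeneous. -/
lemma sum_singVals_smul (c : ℝ) (X : Matrix (Fin N) (Fin N) ℝ) (f : ℝ → ℝ) :
    ∑ i, f (singVals (c • X) i) = ∑ i, f (|c| * singVals X i) := by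
  set hA := isHermitian_conjTranspose_mul_self X
  set hB := isHermitian_conjTranspose_mul_self (c • X)
  have hsmul : (c • X)ᴴ * (c • X) = cfc (fun x : ℝ => c ^ 2 * x) (Xᴴ * X) := by
    have hsa : IsSelfAdjoint (Xᴴ * X) := hA
    rw [cfc_const_mul_id (c ^ 2) (Xᴴ * X) hsa]
    simp [smul_smul, sq]
  have hroots : Finset.univ.val.map hB.eigenvalues =
      Finset.univ.val.map fun i => c ^ 2 * hA.eigenvalues i := by
    have h1 := hB.roots_charpoly_eq_eigenvalues
    have h2 := hA.charpoly_cfc_eq (fun x => c ^ 2 * x)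
    rw [← hsmul] at h2
    rw [h2] at h1
    have h3 := Polynomial.roots_multiset_prod_X_sub_C
      (Finset.univ.val.map fun i => c ^ 2 * hA.eigenvalues i)
    rw [Multiset.map_map] at h3
    exact h1.symm.trans h3
  have h := congrArg (fun s => (s.map fun x => f (Real.sqrt x)).sum) hroots
  simp only [Multiset.map_map] at h
  refine Eq.trans h ?_
  change ∑ i, f (Real.sqrt (c ^ 2 * hA.eigenvalues i)) = _
  simp only [Real.sqrt_mul (sq_nonneg c), Real.sqrt_sq_eq_abs]
  rfl

lemma card_singVals_ne_zero (X : Matrix (Fin N) (Fin N) ℝ) :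
    (Finset.univ.filter fun i => singVals X i ≠ 0).card = X.rank := by
  rw [← rank_conjTranspose_mul_self X,
    (isHermitian_conjTranspose_mul_self X).rank_eq_card_non_zero_eigs, Fintype.card_subtype]
  congr 1
  ext i
  rw [Finset.mem_filter, Finset.mem_filter, ← singVals_sq, ne_eq, ne_eq,
    pow_eq_zero_iff two_ne_zero]

end Schatten

section Interpolation

/-- Hölder's inequality in its log-convex form. -/
lemma sum_rpow_mul_rpow_le {ι : Type*} (s : Finset ι) (f g : ι → ℝ) (hf : ∀ i ∈ s, 0 ≤ f i)
    (hg : ∀ i ∈ s, 0 ≤ g i) (hfs : 0 < ∑ i ∈ s, f i) (hgs : 0 < ∑ i ∈ s, g i) {a b : ℝ}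
    (ha : 0 ≤ a) (hb : 0 ≤ b) (hab : a + b = 1) :
    ∑ i ∈ s, f i ^ a * g i ^ b ≤ (∑ i ∈ s, f i) ^ a * (∑ i ∈ s, g i) ^ b := by
  set P := ∑ i ∈ s, f i with hP
  set Q := ∑ i ∈ s, g i with hQ
  have hpt : ∀ i ∈ s, f i ^ a * g i ^ b ≤ P ^ a * Q ^ b * (a * (f i / P) + b * (g i / Q)) := by
    intro i hi
    have h := Real.geom_mean_le_arith_mean2_weighted ha hb
      (div_nonneg (hf i hi) hfs.le) (div_nonneg (hg i hi) hgs.le) hab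
    rw [Real.div_rpow (hf i hi) hfs.le, Real.div_rpow (hg i hi) hgs.le] at h
    have hPa : 0 < P ^ a := Real.rpow_pos_of_pos hfs a
    have hQb : 0 < Q ^ b := Real.rpow_pos_of_pos hgs b
    calc f i ^ a * g i ^ b = P ^ a * Q ^ b * (f i ^ a / P ^ a * (g i ^ b / Q ^ b)) := by
          field_simp
      _ ≤ _ := by gcongr
  refine (Finset.sum_le_sum hpt).trans (le_of_eq ?_)
  rw [← Finset.mul_sum, Finset.sum_add_distrib, ← Finset.mul_sum, ← Finset.mul_sum,
    ← Finset.sum_div, ← Finset.sum_div, ← hP, ← hQ, div_self hfs.ne', div_self hgs.ne', mul_one,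
    mul_one, hab, mul_one]

/-- Interpolation of `ℓ_q` between `ℓ_p` and `ℓ_2`. -/
lemma sum_rpow_le_interpolate {ι : Type*} (s : Finset ι) (a : ι → ℝ) (ha : ∀ i, 0 ≤ a i)
    {p q : ℝ} (hp : 0 < p) (hp2 : p < 2) (hpq : p ≤ q) (hq2 : q ≤ 2)
    (hne : 0 < ∑ i ∈ s, a i ^ 2) :
    ∑ i ∈ s, a i ^ q ≤
      (∑ i ∈ s, a i ^ p) ^ ((2 - q) / (2 - p)) * (∑ i ∈ s, a i ^ 2) ^ ((q - p) / (2 - p)) := by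
  have h2p : 0 < 2 - p := by linarith
  have hP : 0 < ∑ i ∈ s, a i ^ p := by
    obtain ⟨i, hi, hai⟩ := Finset.exists_ne_zero_of_sum_ne_zero hne.ne'
    refine Finset.sum_pos' (fun j _ => Real.rpow_nonneg (ha j) p) ⟨i, hi, ?_⟩
    exact Real.rpow_pos_of_pos (lt_of_le_of_ne (ha i) fun h => hai (by simp [← h])) p
  refine le_trans (Finset.sum_le_sum fun i _ => le_of_eq ?_) (sum_rpow_mul_rpow_le s
    (fun i => a i ^ p) (fun i => a i ^ 2) (fun i _ => Real.rpow_nonneg (ha i) p)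
    (fun i _ => sq_nonneg _) hP hne (div_nonneg (by linarith) h2p.le)
    (div_nonneg (by linarith) h2p.le) (by field_simp; ring))
  rw [← Real.rpow_natCast (a i) 2, ← Real.rpow_mul (ha i), ← Real.rpow_mul (ha i),
    ← Real.rpow_add_of_nonneg (ha i)
      (mul_nonneg hp.le (div_nonneg (by linarith) h2p.le))
      (mul_nonneg (by norm_num) (div_nonneg (by linarith) h2p.le))]
  congr 1
  push_cast
  field_simp
  ring

/-- If the `ℓ_2` norm is at most `√D` times the `ℓ_1` norm, then the `ℓ_q` quasi-norm of a vector
in the unit ball of `ℓ_p` is at most `D ^ (1 / p - 1 / q)`. -/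
lemma lq_le_of_l2_le_l1 {ι : Type*} (s : Finset ι) (a : ι → ℝ) (ha : ∀ i, 0 ≤ a i)
    {p q D : ℝ} (hp : 0 < p) (hp1 : p ≤ 1) (hpq : p < q) (hq2 : q ≤ 2) (hD : 0 ≤ D)
    (hP : ∑ i ∈ s, a i ^ p ≤ 1) (h21 : ∑ i ∈ s, a i ^ 2 ≤ D * (∑ i ∈ s, a i) ^ 2) :
    (∑ i ∈ s, a i ^ q) ^ (1 / q) ≤ D ^ (1 / p - 1 / q) := by
  have hq : 0 < q := hp.trans hpq
  have h2p : 0 < 2 - p := by linarith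
  have hP0 : 0 ≤ ∑ i ∈ s, a i ^ p := Finset.sum_nonneg fun i _ => Real.rpow_nonneg (ha i) p
  rcases (Finset.sum_nonneg fun i _ => sq_nonneg (a i) : 0 ≤ ∑ i ∈ s, a i ^ 2).eq_or_lt
    with hQ | hQ
  · have hz : ∑ i ∈ s, a i ^ q = 0 := by
      refine Finset.sum_eq_zero fun i hi => ?_
      have h := (Finset.sum_eq_zero_iff_of_nonneg fun i _ => sq_nonneg (a i)).1 hQ.symm i hi
      rw [pow_eq_zero_iff two_ne_zero] at h
      rw [h, Real.zero_rpow hq.ne']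
    rw [hz, Real.zero_rpow (by positivity)]
    exact Real.rpow_nonneg hD _
  set Q := ∑ i ∈ s, a i ^ 2 with hQdef
  have bound : ∀ r, p ≤ r → r ≤ 2 → ∑ i ∈ s, a i ^ r ≤ Q ^ ((r - p) / (2 - p)) := by
    intro r hpr hr2
    refine (sum_rpow_le_interpolate s a ha hp (by linarith) hpr hr2 hQ).trans ?_
    exact mul_le_of_le_one_left (Real.rpow_nonneg hQ.le _)
      (Real.rpow_le_one hP0 hP (div_nonneg (by linarith) h2p.le))
  have h1 : ∑ i ∈ s, a i ≤ Q ^ ((1 - p) / (2 - p)) := by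
    simpa using bound 1 hp1 one_le_two
  have hQD : Q ^ (p / (2 - p)) ≤ D := by
    have h3 : Q ≤ D * Q ^ (2 * ((1 - p) / (2 - p))) := by
      refine h21.trans (mul_le_mul_of_nonneg_left ?_ hD)
      rw [mul_comm 2, Real.rpow_mul hQ.le, Real.rpow_two]
      exact pow_le_pow_left₀ (Finset.sum_nonneg fun i _ => ha i) h1 2
    have h4 : Q = Q ^ (p / (2 - p)) * Q ^ (2 * ((1 - p) / (2 - p))) := by
      rw [← Real.rpow_add hQ]
      conv_lhs => rw [← Real.rpow_one Q]
      congr 1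
      field_simp
      ring
    refine le_of_mul_le_mul_right ?_ (Real.rpow_pos_of_pos hQ (2 * ((1 - p) / (2 - p))))
    rw [← h4]
    exact h3
  calc (∑ i ∈ s, a i ^ q) ^ (1 / q) ≤ (Q ^ ((q - p) / (2 - p))) ^ (1 / q) :=
        Real.rpow_le_rpow (Finset.sum_nonneg fun i _ => Real.rpow_nonneg (ha i) q)
          (bound q hpq.le hq2) (by positivity)
    _ = (Q ^ (p / (2 - p))) ^ (1 / p - 1 / q) := by
        rw [← Real.rpow_mul hQ.le, ← Real.rpow_mul hQ.le]
        congr 1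
        field_simp
    _ ≤ D ^ (1 / p - 1 / q) := by
        refine Real.rpow_le_rpow (Real.rpow_nonneg hQ.le _) hQD ?_
        exact sub_nonneg.2 (one_div_le_one_div_of_le hp hpq.le)

/-- Comparison of `ℓ_p` and `ℓ_q` for vectors with at most `r` nonzero entries. -/
lemma sum_rpow_le_card_rpow {ι : Type*} (s : Finset ι) (a : ι → ℝ) (ha : ∀ i, 0 ≤ a i)
    {p q : ℝ} (hp : 0 < p) (hpq : p ≤ q) (hQ : 0 < ∑ i ∈ s, a i ^ q) :
    ∑ i ∈ s, a i ^ p ≤ (∑ i ∈ s, a i ^ q) ^ (p / q) * (s.card : ℝ) ^ (1 - p / q) := by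
  have hq : 0 < q := hp.trans_le hpq
  have hs : s.Nonempty := Finset.nonempty_of_sum_ne_zero hQ.ne'
  have h := sum_rpow_mul_rpow_le s (fun i => a i ^ q) (fun _ => 1)
    (fun i _ => Real.rpow_nonneg (ha i) q) (fun _ _ => zero_le_one) hQ
    (by simpa using hs) (a := p / q) (b := 1 - p / q) (by positivity)
    (sub_nonneg.2 ((div_le_one hq).2 hpq)) (by ring)
  simp only [Real.one_rpow, mul_one, Finset.sum_const, nsmul_eq_mul] at h
  refine le_trans (Finset.sum_le_sum fun i _ => le_of_eq ?_) h
  rw [← Real.rpow_mul (ha i), mul_div_cancel₀ _ hq.ne']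

end Interpolation

section GelfandWidth

open Matrix

variable {N : ℕ}

lemma sum_singVals_rpow_nonneg (p : ℝ) (X : Matrix (Fin N) (Fin N) ℝ) :
    0 ≤ ∑ i, singVals X i ^ p :=
  Finset.sum_nonneg fun i _ => Real.rpow_nonneg (singVals_nonneg X i) p

lemma schattenNorm_nonneg (p : ℝ) (X : Matrix (Fin N) (Fin N) ℝ) : 0 ≤ schattenNorm p X :=
  Real.rpow_nonneg (sum_singVals_rpow_nonneg p X) _

lemma sum_singVals_rpow_le_one {p : ℝ} (hp : 0 < p) {X : Matrix (Fin N) (Fin N) ℝ}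
    (hX : schattenNorm p X ≤ 1) : ∑ i, singVals X i ^ p ≤ 1 := by
  by_contra! h
  exact (Real.one_lt_rpow h (one_div_pos.2 hp)).not_ge hX

lemma schattenNorm_le_one_of_le {p q : ℝ} (hp : 0 < p) (hpq : p ≤ q)
    {X : Matrix (Fin N) (Fin N) ℝ} (hX : schattenNorm p X ≤ 1) : schattenNorm q X ≤ 1 := by
  have hP := sum_singVals_rpow_le_one hp hX
  have hσ : ∀ i, singVals X i ≤ 1 := by
    intro i
    by_contra! h
    have h1 := Real.one_lt_rpow h hp
    have h2 := Finset.single_le_sum (f := fun i => singVals X i ^ p)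
      (fun j _ => Real.rpow_nonneg (singVals_nonneg X j) p) (Finset.mem_univ i)
    exact (h1.trans_le (h2.trans hP)).false
  refine Real.rpow_le_one (sum_singVals_rpow_nonneg q X) (le_trans ?_ hP)
    (one_div_pos.2 (hp.trans_le hpq)).le
  refine Finset.sum_le_sum fun i _ => ?_
  exact Real.rpow_le_rpow_of_exponent_ge' (singVals_nonneg X i) (hσ i) hp.le hpq

lemma gelfandWidth_le (m : ℕ) (K : Set (Matrix (Fin N) (Fin N) ℝ)) (q B : ℝ) (hB : 0 ≤ B)
    (L : Submodule ℝ (Matrix (Fin N) (Fin N) ℝ))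
    (hL : Module.finrank ℝ (Matrix (Fin N) (Fin N) ℝ ⧸ L) ≤ m)
    (h : ∀ X ∈ K, X ∈ L → schattenNorm q X ≤ B) : gelfandWidth m K q ≤ B := by
  unfold gelfandWidth
  refine le_trans (csInf_le ⟨0, ?_⟩ ⟨L, hL, rfl⟩) (Real.sSup_le ?_ hB)
  · rintro _ ⟨L', -, rfl⟩
    refine Real.sSup_nonneg ?_
    rintro _ ⟨X, -, rfl⟩
    exact schattenNorm_nonneg q X
  · rintro _ ⟨X, ⟨hK, hXL⟩, rfl⟩
    exact h X hK hXL

lemma le_gelfandWidth (m : ℕ) (K : Set (Matrix (Fin N) (Fin N) ℝ)) (q b : ℝ)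
    (hK : BddAbove (schattenNorm q '' K))
    (h : ∀ L : Submodule ℝ (Matrix (Fin N) (Fin N) ℝ),
      Module.finrank ℝ (Matrix (Fin N) (Fin N) ℝ ⧸ L) ≤ m →
        ∃ X ∈ K, X ∈ L ∧ b ≤ schattenNorm q X) : b ≤ gelfandWidth m K q := by
  refine le_csInf ⟨_, ⊤, ?_, rfl⟩ ?_
  · rw [Module.finrank_zero_of_subsingleton]
    exact Nat.zero_le m
  · rintro _ ⟨L, hL, rfl⟩
    obtain ⟨X, hX, hXL, hb⟩ := h L hL
    exact hb.trans (le_csSup (hK.mono (Set.image_mono Set.inter_subset_left))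
      ⟨X, ⟨hX, hXL⟩, rfl⟩)

/-- A subspace of codimension less than `r * N` contains a nonzero matrix of rank at most `r`. -/
lemma exists_mem_rank_le {r m : ℕ} (hr : r ≤ N) (hm : m < r * N)
    (L : Submodule ℝ (Matrix (Fin N) (Fin N) ℝ))
    (hL : Module.finrank ℝ (Matrix (Fin N) (Fin N) ℝ ⧸ L) ≤ m) :
    ∃ X ∈ L, X ≠ 0 ∧ X.rank ≤ r := by
  let E : Matrix (Fin N) (Fin r) ℝ := (1 : Matrix (Fin N) (Fin N) ℝ).submatrix id (Fin.castLE hr)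
  let φ : Matrix (Fin r) (Fin N) ℝ →ₗ[ℝ] Matrix (Fin N) (Fin N) ℝ := mulLeftLinearMap (Fin N) ℝ E
  have hker : LinearMap.ker (L.mkQ ∘ₗ φ) ≠ ⊥ := by
    apply LinearMap.ker_ne_bot_of_finrank_lt
    rw [Module.finrank_matrix]
    simpa using hL.trans_lt hm
  obtain ⟨Y, hY, hY0⟩ := (Submodule.ne_bot_iff _).1 hker
  refine ⟨E * Y, ?_, fun h => hY0 ?_, (rank_mul_le_left E Y).trans (rank_le_width E)⟩
  · rw [LinearMap.mem_ker, LinearMap.comp_apply, Submodule.mkQ_apply,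
      Submodule.Quotient.mk_eq_zero] at hY
    exact hY
  · ext i j
    have := congrFun (congrFun h (Fin.castLE hr i)) j
    simpa [E, mul_apply, one_apply, Fin.castLE_inj] using this

/-- Every nonzero matrix of rank at most `r` has a multiple on the unit sphere of `S_p` whose
`S_q` quasi-norm is at least `r ^ (1 / q - 1 / p)`. -/
lemma exists_smul_schattenNorm_ge {r : ℕ} {p q : ℝ} (hp : 0 < p) (hpq : p ≤ q)
    {X : Matrix (Fin N) (Fin N) ℝ} (hX : X ≠ 0) (hrank : X.rank ≤ r) :
    ∃ c : ℝ, schattenNorm p (c • X) ≤ 1 ∧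
      1 ≤ schattenNorm q (c • X) * (r : ℝ) ^ (1 / p - 1 / q) := by
  have hq : 0 < q := hp.trans_le hpq
  have hP : 0 < ∑ i, singVals X i ^ p := by
    have h2 : ∑ i, singVals X i ^ 2 ≠ 0 := by
      intro h
      apply hX
      rw [sum_singVals_sq] at h
      have hrow := (Finset.sum_eq_zero_iff_of_nonneg
        fun j _ => Finset.sum_nonneg fun l _ => sq_nonneg (X j l)).1 h
      ext j l
      have hj := (Finset.sum_eq_zero_iff_of_nonneg fun l _ => sq_nonneg (X j l)).1
        (hrow j (Finset.mem_univ j)) l (Finset.mem_univ l)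
      simpa using hj
    obtain ⟨i, -, hi⟩ := Finset.exists_ne_zero_of_sum_ne_zero h2
    refine Finset.sum_pos' (fun j _ => Real.rpow_nonneg (singVals_nonneg X j) p)
      ⟨i, Finset.mem_univ i, Real.rpow_pos_of_pos ?_ p⟩
    exact lt_of_le_of_ne (singVals_nonneg X i) fun h => hi (by simp [← h])
  set P := ∑ i, singVals X i ^ p with hPdef
  set c := P ^ (-(1 / p)) with hc
  have c_pos : 0 < c := Real.rpow_pos_of_pos hP _
  set a := singVals (c • X) with ha
  have a_nonneg : ∀ i, 0 ≤ a i := singVals_nonneg _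
  have hone : ∑ i, a i ^ p = 1 := by
    rw [ha, sum_singVals_smul c X (fun x => x ^ p)]
    simp only [Real.mul_rpow (abs_nonneg c) (singVals_nonneg X _)]
    rw [← Finset.mul_sum, ← hPdef, abs_of_pos c_pos, hc, ← Real.rpow_mul hP.le, neg_mul,
      one_div_mul_cancel hp.ne', Real.rpow_neg_one, inv_mul_cancel₀ hP.ne']
  refine ⟨c, ?_, ?_⟩
  · rw [schattenNorm, ← ha, hone, Real.one_rpow]
  set s := Finset.univ.filter fun i => a i ≠ 0 with hs
  have sum_s : ∀ t : ℝ, 0 < t → ∑ i ∈ s, a i ^ t = ∑ i, a i ^ t := by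
    intro t ht
    refine Finset.sum_filter_of_ne fun i _ hi h => hi ?_
    rw [h, Real.zero_rpow ht.ne']
  have card_s : s.card ≤ r := by
    have hmul : c • X = X * (c • (1 : Matrix (Fin N) (Fin N) ℝ)) := by simp
    rw [hs, ha, card_singVals_ne_zero, hmul]
    exact (rank_mul_le_left _ _).trans hrank
  have hQ : 0 < ∑ i, a i ^ q := by
    obtain ⟨i, -, hi⟩ := Finset.exists_ne_zero_of_sum_ne_zero (hone.trans_ne one_ne_zero)
    refine Finset.sum_pos' (fun j _ => Real.rpow_nonneg (a_nonneg j) q)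
      ⟨i, Finset.mem_univ i, Real.rpow_pos_of_pos ?_ q⟩
    exact lt_of_le_of_ne (a_nonneg i) fun h => hi (by rw [← h, Real.zero_rpow hp.ne'])
  have key := sum_rpow_le_card_rpow s a a_nonneg hp hpq ((sum_s q hq).symm ▸ hQ)
  rw [sum_s p hp, sum_s q hq, hone] at key
  have key' : 1 ≤ (∑ i, a i ^ q) ^ (p / q) * (r : ℝ) ^ (1 - p / q) := by
    refine key.trans (mul_le_mul_of_nonneg_left ?_ (Real.rpow_nonneg hQ.le _))
    exact Real.rpow_le_rpow (Nat.cast_nonneg _) (Nat.cast_le.2 card_s)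
      (sub_nonneg.2 ((div_le_one hq).2 hpq))
  have h := Real.one_le_rpow key' (one_div_pos.2 hp).le
  rw [Real.mul_rpow (Real.rpow_nonneg hQ.le _) (Real.rpow_nonneg (Nat.cast_nonneg r) _),
    ← Real.rpow_mul hQ.le, ← Real.rpow_mul (Nat.cast_nonneg r)] at h
  have e1 : p / q * (1 / p) = 1 / q := by field_simp
  have e2 : (1 - p / q) * (1 / p) = 1 / p - 1 / q := by field_simp
  rwa [e1, e2] at h

/-- There is a subspace of codimension at most `m` on which the Frobenius norm is at most a
multiple of `√(N / m)` times the nuclear norm. -/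
lemma exists_submodule_frobenius_le_nuclear {m : ℕ} (hN : 0 < N) (hm : 0 < m) :
    ∃ L : Submodule ℝ (Matrix (Fin N) (Fin N) ℝ),
      Module.finrank ℝ (Matrix (Fin N) (Fin N) ℝ ⧸ L) ≤ m ∧
      ∀ X ∈ L, ∑ i, singVals X i ^ 2 ≤ 256 ^ 2 * ((N : ℝ) / m) * (∑ i, singVals X i) ^ 2 := by
  obtain ⟨a, ha⟩ := exists_signs_frobenius_le hN hm
    (fun x => ∑ i, singVals (Matrix.of fun j l => x (j, l)) i)
    (fun x => Finset.sum_nonneg fun i _ => singVals_nonneg _ i)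
    (fun x S M hS => sum_mul_le_of_bilinBound (Matrix.of fun j l => x (j, l)) S M hS)
  let ψ : Matrix (Fin N) (Fin N) ℝ →ₗ[ℝ] (Fin m → ℝ) :=
    { toFun := fun X i => signForm (a i) fun z => X z.1 z.2
      map_add' := fun X Y => by
        ext i
        simp [signForm, mul_add, Finset.sum_add_distrib]
      map_smul' := fun c X => by
        ext i
        simp [signForm, Finset.mul_sum, mul_left_comm] }
  refine ⟨LinearMap.ker ψ, ?_, fun X hX => ?_⟩
  · rw [ψ.quotKerEquivRange.finrank_eq]
    simpa using Submodule.finrank_le (LinearMap.range ψ)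
  · have h := ha (fun z => X z.1 z.2) fun i => congrFun (LinearMap.mem_ker.1 hX) i
    change _ ≤ 256 * (Real.sqrt N / Real.sqrt m) * ∑ i, singVals X i at h
    have h2 := pow_le_pow_left₀ (Real.sqrt_nonneg _) h 2
    rw [Real.sq_sqrt (Finset.sum_nonneg fun _ _ => sq_nonneg _), Fintype.sum_prod_type, mul_pow,
      mul_pow, div_pow, Real.sq_sqrt (Nat.cast_nonneg N), Real.sq_sqrt (Nat.cast_nonneg m)] at h2
    rw [sum_singVals_sq]
    exact h2

end GelfandWidth

/-- Two-sided estimate for the Gelfand widths of Schatten `p`-balls measured in the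
Schatten `q`-quasi-norm, for `0 < p ≤ 1` and `p < q ≤ 2`. -/
theorem gelfand_width_schatten_ball
    (p q : ℝ) (hp0 : 0 < p) (hp1 : p ≤ 1) (hpq : p < q) (hq2 : q ≤ 2) :
    ∃ c C : ℝ, 0 < c ∧ 0 < C ∧
      ∀ N m : ℕ, 0 < N → 1 ≤ m → m < N ^ 2 →
        c * (min 1 ((N : ℝ) / m)) ^ (1 / p - 1 / q) ≤
            gelfandWidth m {X : Matrix (Fin N) (Fin N) ℝ | schattenNorm p X ≤ 1} q ∧
        gelfandWidth m {X : Matrix (Fin N) (Fin N) ℝ | schattenNorm p X ≤ 1} q ≤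
            C * (min 1 ((N : ℝ) / m)) ^ (1 / p - 1 / q) := by
  have he : 0 ≤ 1 / p - 1 / q := sub_nonneg.2 (one_div_le_one_div_of_le hp0 hpq.le)
  set e := 1 / p - 1 / q with he_def
  refine ⟨(1 / 2) ^ e, (256 ^ 2) ^ e, by positivity, by positivity, ?_⟩
  intro N m hN hm hmN
  have hN' : (0 : ℝ) < N := Nat.cast_pos.2 hN
  have hm' : (0 : ℝ) < m := Nat.cast_pos.2 hm
  constructor
  · refine le_gelfandWidth m _ q _ ⟨1, ?_⟩ fun L hL => ?_
    · rintro _ ⟨X, hX, rfl⟩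
      exact schattenNorm_le_one_of_le hp0 hpq.le hX
    have hr : m / N + 1 ≤ N := Nat.div_lt_of_lt_mul (by rwa [← sq])
    obtain ⟨X, hXL, hX0, hrank⟩ := exists_mem_rank_le hr
      (by rw [mul_comm]; exact Nat.lt_mul_div_succ m hN) L hL
    obtain ⟨c, hcp, hcq⟩ := exists_smul_schattenNorm_ge hp0 hpq.le hX0 hrank
    refine ⟨c • X, hcp, L.smul_mem c hXL, ?_⟩
    set r : ℝ := ((m / N + 1 : ℕ) : ℝ) with hr_def
    have r_pos : 0 < r := by positivity
    have r_le : r ≤ m / N + 1 := by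
      rw [hr_def]
      push_cast
      gcongr
      exact Nat.cast_div_le
    have hmin : 1 / 2 * min 1 ((N : ℝ) / m) ≤ 1 / r := by
      rw [le_div_iff₀ r_pos]
      have h0 : 0 ≤ min 1 ((N : ℝ) / m) := by positivity
      have h1 : min 1 ((N : ℝ) / m) * (m / N) ≤ 1 := by
        calc min 1 ((N : ℝ) / m) * (m / N) ≤ N / m * (m / N) := by
              gcongr
              exact min_le_right _ _
          _ = 1 := by field_simp
      nlinarith [min_le_left 1 ((N : ℝ) / m), mul_le_mul_of_nonneg_left r_le h0]
    calc (1 / 2) ^ e * (min 1 ((N : ℝ) / m)) ^ e = (1 / 2 * min 1 ((N : ℝ) / m)) ^ e :=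
          (Real.mul_rpow (by norm_num) (by positivity)).symm
      _ ≤ (1 / r) ^ e := Real.rpow_le_rpow (by positivity) hmin he
      _ = 1 / r ^ e := by rw [Real.div_rpow zero_le_one r_pos.le, Real.one_rpow]
      _ ≤ schattenNorm q (c • X) := (div_le_iff₀ (Real.rpow_pos_of_pos r_pos e)).2 hcq
  · rcases le_total m N with h | h
    · have hmin : min 1 ((N : ℝ) / m) = 1 :=
        min_eq_left ((one_le_div hm').2 (Nat.cast_le.2 h))
      rw [hmin, Real.one_rpow, mul_one]
      refine gelfandWidth_le m _ q _ (by positivity) ⊤ ?_ fun X hX _ => ?_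
      · rw [Module.finrank_zero_of_subsingleton]
        exact Nat.zero_le m
      · exact (schattenNorm_le_one_of_le hp0 hpq.le hX).trans (Real.one_le_rpow (by norm_num) he)
    · have hmin : min 1 ((N : ℝ) / m) = N / m :=
        min_eq_right ((div_le_one hm').2 (Nat.cast_le.2 h))
      rw [hmin, ← Real.mul_rpow (by norm_num) (by positivity)]
      obtain ⟨L, hL, hLX⟩ := exists_submodule_frobenius_le_nuclear hN hm
      refine gelfandWidth_le m _ q _ (by positivity) L hL fun X hX hXL => ?_
      exact lq_le_of_l2_le_l1 Finset.univ (singVals X) (singVals_nonneg X) hp0 hp1 hpq hq2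
        (by positivity) (sum_singVals_rpow_le_one hp0 hX) (hLX X hXL)
end
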